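/- arXiv:2503.00157 — 2 statements merged into one kernel-verified Lean document; each statement's English description precedes it below -/
import Mathlib

section
/- There exists a convex function h ∈ C²(ℝ^d, ℝ) with ∇h and ∇²h bounded, such that h(m) = 0 for all m ∈ D and the function w_h satisfies: w_h ∈ C²(ℝ^d, ℝ), ∇²w_h is bounded below (∇²w_h(θ) ≥ K·Id for some K ∈ ℝ and all θ), and there exist θ* ∈ ℝ^d and η > 0 with (θ − θ*)·∇w_h(θ) ≥ η·|θ − θ*|² for all θ ∈ ℝ^d. -/
open MeasureTheory Real Filter Set
open scoped RealInnerProductSpace ENNReal NNReal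

noncomputable section

/-- `ℝ^d` as a Euclidean space. -/
abbrev Euc (d : ℕ) := EuclideanSpace ℝ (Fin d)

/-- The probability measure with density proportional to a given nonnegative function. -/
def probOfDensity {α : Type*} [MeasureSpace α] (g : α → ℝ) : Measure α :=
  (ENNReal.ofReal (∫ x, g x))⁻¹ • (volume.withDensity fun x => ENNReal.ofReal (g x))

/-- The probability measure `ν_m ∝ exp(−(1/σ²)[V(x) + |x−m|²/2])` on `ℝ^d`. -/
def nuMeas {d : ℕ} (σ : ℝ) (V : Euc d → ℝ) (m : Euc d) : Measure (Euc d) :=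
  probOfDensity (fun x => Real.exp (-(1 / σ ^ 2) * (V x + ‖x - m‖ ^ 2 / 2)))

/-- The mean of `ν_m`: `f(m) = ∫ x ν_m(dx)`. -/
def fMap {d : ℕ} (σ : ℝ) (V : Euc d → ℝ) (m : Euc d) : Euc d :=
  ∫ x, x ∂(nuMeas σ V m)
/-- A probability density on `ℝ^d` with finite second moment, integrable entropy and
integrable energy (densities with non-integrable energy have `F_θ(μ) = +∞` and do not
contribute to the infimum defining `w`). -/
structure AdmissibleDensity {d : ℕ} (V₀ : Euc d → ℝ) (ρ : Euc d → ℝ) : Prop where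
  meas : Measurable ρ
  nonneg : ∀ x, 0 ≤ ρ x
  total : (∫ x, ρ x) = 1
  mom2 : Integrable (fun x => ρ x * ‖x‖ ^ 2)
  ent : Integrable (fun x => ρ x * Real.log (ρ x))
  energy : Integrable (fun x => ρ x * V₀ x)

/-- The mean `m_μ = ∫ x μ(x) dx` of a density. -/
def densMean {d : ℕ} (ρ : Euc d → ℝ) : Euc d := ∫ x, ρ x • x

/-- The free energy `F_θ(μ) = ∫ (V₀ − x·θ) μ + h(m_μ) + ∫ μ log μ`. -/
def freeEnergy {d : ℕ} (V₀ h : Euc d → ℝ) (θ : Euc d) (ρ : Euc d → ℝ) : ℝ :=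
  (∫ x, ρ x * (V₀ x - ⟪x, θ⟫)) + h (densMean ρ) + ∫ x, ρ x * Real.log (ρ x)

/-- `w(θ) = |θ|²/(2κ) + inf_μ F_θ(μ)`. -/
def wFun {d : ℕ} (V₀ h : Euc d → ℝ) (κ : ℝ) (θ : Euc d) : ℝ :=
  ‖θ‖ ^ 2 / (2 * κ) + sInf {r : ℝ | ∃ ρ, AdmissibleDensity V₀ ρ ∧ r = freeEnergy V₀ h θ ρ}

section ConvexGradient

open scoped Topology

variable {E : Type*} [NormedAddCommGroup E] [InnerProductSpace ℝ E]

/-- `g` selects a global subgradient of `F` at every point. -/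
def IsSubgradient (F : E → ℝ) (g : E → E) : Prop :=
  ∀ x y, F x + ⟪g x, y - x⟫ ≤ F y

namespace IsSubgradient

variable {F : E → ℝ} {g : E → E}

lemma inner_nonneg (h : IsSubgradient F g) (x y : E) : 0 ≤ ⟪g x - g y, x - y⟫ := by
  have h1 := h x y
  have h2 := h y x
  have e : y - x = -(x - y) := by abel
  rw [e, inner_neg_right] at h1
  rw [inner_sub_left]
  linarith

lemma convexOn (h : IsSubgradient F g) : ConvexOn ℝ univ F := by
  refine ⟨convex_univ, fun x _ y _ a b ha hb hab => ?_⟩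
  set z := a • x + b • y with hz
  have h1 := mul_le_mul_of_nonneg_left (h z x) ha
  have h2 := mul_le_mul_of_nonneg_left (h z y) hb
  have h3 : a * ⟪g z, x - z⟫ + b * ⟪g z, y - z⟫ = 0 := by
    rw [← inner_smul_right, ← inner_smul_right, ← inner_add_right]
    have : a • (x - z) + b • (y - z) = 0 := by
      have : a • (x - z) + b • (y - z) = z - (a + b) • z := by
        rw [hz]; module
      rw [this, hab]; simp
    rw [this, inner_zero_right]
  have h4 : F z = a * F z + b * F z := by rw [← add_mul, hab, one_mul]
  simp only [smul_eq_mul]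
  nlinarith

/-- A subgradient bound `F y - F x - ⟪g x, y - x⟫ ≤ K ‖y - x‖²` for Lipschitz `g`. -/
lemma le_add_sq (h : IsSubgradient F g) {K : ℝ} (hK : ∀ x y, ‖g x - g y‖ ≤ K * ‖x - y‖)
    (x y : E) : F y ≤ F x + ⟪g x, y - x⟫ + K * ‖y - x‖ ^ 2 := by
  have h1 := h y x
  have e : x - y = -(y - x) := by abel
  rw [e, inner_neg_right] at h1
  have h2 : ⟪g y - g x, y - x⟫ ≤ K * ‖y - x‖ ^ 2 :=
    calc _ ≤ ‖g y - g x‖ * ‖y - x‖ := real_inner_le_norm _ _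
      _ ≤ (K * ‖y - x‖) * ‖y - x‖ := by gcongr; exact hK y x
      _ = _ := by ring
  rw [inner_sub_left] at h2
  linarith

/-- Co-coercivity of Lipschitz gradients of convex functions, with a non-sharp constant. -/
lemma cocoercive (h : IsSubgradient F g) {K : ℝ} (hK0 : 0 < K)
    (hK : ∀ x y, ‖g x - g y‖ ≤ K * ‖x - y‖) (x y : E) :
    ‖g x - g y‖ ^ 2 ≤ 2 * K * ⟪g x - g y, x - y⟫ := by
  have key : ∀ x y : E, F y + ⟪g y, x - y⟫ + ‖g x - g y‖ ^ 2 / (4 * K) ≤ F x := by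
    intro x y
    set s : ℝ := 1 / (2 * K) with hs
    have h1 := h y (x - s • (g x - g y))
    have h2 := h.le_add_sq hK x (x - s • (g x - g y))
    have e1 : x - s • (g x - g y) - y = (x - y) - s • (g x - g y) := by abel
    have e2 : x - s • (g x - g y) - x = -(s • (g x - g y)) := by abel
    rw [e1, inner_sub_right, inner_smul_right] at h1
    rw [e2, inner_neg_right, inner_smul_right, norm_neg, norm_smul, mul_pow,
      Real.norm_eq_abs, sq_abs] at h2
    have e3 : ⟪g x, g x - g y⟫ - ⟪g y, g x - g y⟫ = ‖g x - g y‖ ^ 2 := by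
      rw [← inner_sub_left, real_inner_self_eq_norm_sq]
    have e4 : s * ‖g x - g y‖ ^ 2 - K * (s ^ 2 * ‖g x - g y‖ ^ 2)
        = ‖g x - g y‖ ^ 2 / (4 * K) := by
      rw [hs]; field_simp; ring
    have e5 : s * ⟪g x, g x - g y⟫ - s * ⟪g y, g x - g y⟫ = s * ‖g x - g y‖ ^ 2 := by
      rw [← mul_sub, e3]
    linarith
  have h1 := key x y
  have h2 := key y x
  have e : y - x = -(x - y) := by abel
  rw [e, inner_neg_right, norm_sub_rev] at h2
  have h3 : ‖g x - g y‖ ^ 2 / (2 * K) ≤ ⟪g x - g y, x - y⟫ := by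
    have : ‖g x - g y‖ ^ 2 / (2 * K)
        = ‖g x - g y‖ ^ 2 / (4 * K) + ‖g x - g y‖ ^ 2 / (4 * K) := by
      field_simp; ring
    rw [inner_sub_left, this]
    linarith
  rw [div_le_iff₀ (by positivity)] at h3
  linarith

lemma hasGradientAt [CompleteSpace E] (h : IsSubgradient F g) (hg : Continuous g) (x : E) :
    HasGradientAt F (g x) x := by
  rw [hasGradientAt_iff_isLittleO, Asymptotics.isLittleO_iff]
  intro c hc
  have hev : ∀ᶠ y in 𝓝 x, dist (g y) (g x) < c :=
    hg.continuousAt.eventually (Metric.ball_mem_nhds _ hc)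
  filter_upwards [hev] with y hy
  have h1 := h x y
  have h2 := h y x
  have e : x - y = -(y - x) := by abel
  rw [e, inner_neg_right] at h2
  have h3 : ⟪g y - g x, y - x⟫ ≤ c * ‖y - x‖ := by
    refine (real_inner_le_norm _ _).trans ?_
    gcongr
    rw [← dist_eq_norm]; exact hy.le
  rw [inner_sub_left] at h3
  rw [Real.norm_eq_abs, abs_of_nonneg (by linarith)]
  linarith

end IsSubgradient

lemma contDiff_two_of_hasGradientAt [CompleteSpace E] {F : E → ℝ} {g : E → E}
    (h : ∀ x, HasGradientAt F (g x) x) (hg : ContDiff ℝ 1 g) : ContDiff ℝ 2 F := by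
  have : (2 : WithTop ℕ∞) = ((1 : ℕ) : WithTop ℕ∞) + 1 := by norm_num
  rw [this, contDiff_succ_iff_hasFDerivAt]
  refine ⟨fun x => InnerProductSpace.toDual ℝ E (g x), ?_, fun x => (h x).hasFDerivAt⟩
  exact_mod_cast (InnerProductSpace.toDual ℝ E).toContinuousLinearEquiv.contDiff.comp hg

/-- A differentiable map satisfying `c ‖g x - g y‖² ≤ ⟪g x - g y, x - y⟫` has a derivative
satisfying the same inequality. -/
lemma HasFDerivAt.cocoercive {g : E → E} {g' : E →L[ℝ] E} {x : E} (hg : HasFDerivAt g g' x)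
    {c : ℝ} (h : ∀ x y, c * ‖g x - g y‖ ^ 2 ≤ ⟪g x - g y, x - y⟫) (v : E) :
    c * ‖g' v‖ ^ 2 ≤ ⟪g' v, v⟫ := by
  have hl : HasDerivAt (fun t : ℝ => g (x + t • v)) (g' v) 0 := by
    have h1 : HasDerivAt (fun t : ℝ => x + t • v) v 0 := by
      simpa using ((hasDerivAt_id (0 : ℝ)).smul_const v).const_add x
    have h2 : HasFDerivAt g g' (x + (0 : ℝ) • v) := by simpa using hg
    exact h2.comp_hasDerivAt (0 : ℝ) h1
  have ht := hl.tendsto_slope_zero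
  simp only [zero_add, zero_smul, add_zero] at ht
  refine le_of_tendsto_of_tendsto ((ht.norm.pow 2).const_mul c)
    (ht.inner tendsto_const_nhds) ?_
  filter_upwards [self_mem_nhdsWithin] with t ht0
  have ht0 : t ≠ 0 := ht0
  have := h (x + t • v) x
  rw [add_sub_cancel_left, inner_smul_right] at this
  rw [norm_smul, mul_pow, inner_smul_left, norm_inv, inv_pow, Real.norm_eq_abs, sq_abs]
  simp only [conj_trivial]
  have ht2 : 0 < t ^ 2 := by positivity
  calc c * ((t ^ 2)⁻¹ * ‖g (x + t • v) - g x‖ ^ 2)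
      = (t ^ 2)⁻¹ * (c * ‖g (x + t • v) - g x‖ ^ 2) := by ring
    _ ≤ (t ^ 2)⁻¹ * (t * ⟪g (x + t • v) - g x, v⟫) := by gcongr
    _ = _ := by field_simp

/-- A perturbation `θ ↦ θ + g (M θ)` of the identity, with `g` bounded and monotone and `M`
co-coercive, has a `C¹` inverse. -/
lemma exists_contDiff_inverse [FiniteDimensional ℝ E] {M g : E → E}
    (hM : ContDiff ℝ 1 M) (hg : ContDiff ℝ 1 g) {c : ℝ} (hc : 0 < c)
    (hMc : ∀ x y, c * ‖M x - M y‖ ^ 2 ≤ ⟪M x - M y, x - y⟫)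
    (hgm : ∀ x y, 0 ≤ ⟪g x - g y, x - y⟫) {B : ℝ} (hB : ∀ x, ‖g x‖ ≤ B) :
    ∃ S : E → E, ContDiff ℝ 1 S ∧ ∀ θ, S θ + g (M (S θ)) = θ := by
  have : CompleteSpace E := FiniteDimensional.complete ℝ E
  set T : E → E := fun θ => θ + g (M θ) with hT
  have hTC : ContDiff ℝ 1 T := contDiff_id.add (hg.comp hM)
  have hinj : Function.Injective T := by
    intro x y hxy
    have h1 : x - y = -(g (M x) - g (M y)) := by
      have : x + g (M x) = y + g (M y) := hxy
      rw [neg_sub, sub_eq_sub_iff_add_eq_add, this, add_comm]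
    have h2 := hMc x y
    have h3 := hgm (M x) (M y)
    rw [h1, inner_neg_right, real_inner_comm] at h2
    have h4 : ‖M x - M y‖ ^ 2 ≤ 0 := by
      by_contra h
      push Not at h
      have := mul_pos hc h
      linarith
    have h5 : M x = M y := by
      have : ‖M x - M y‖ = 0 := by
        have := sq_nonneg ‖M x - M y‖
        exact pow_eq_zero_iff two_ne_zero |>.1 (le_antisymm h4 this)
      exact sub_eq_zero.1 (norm_eq_zero.1 this)
    rw [h5] at h1
    exact sub_eq_zero.1 (by simpa using h1)
  have hder : ∀ x, ∃ T' : E ≃L[ℝ] E, HasFDerivAt T (T' : E →L[ℝ] E) x := by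
    intro x
    have hM' := (hM.differentiable (by norm_num) x).hasFDerivAt
    have hg' := (hg.differentiable (by norm_num) (M x)).hasFDerivAt
    set b := fderiv ℝ M x
    set a := fderiv ℝ g (M x)
    have hd : HasFDerivAt T (ContinuousLinearMap.id ℝ E + a.comp b) x :=
      (hasFDerivAt_id x).add (hg'.comp x hM')
    have hinj : Function.Injective (ContinuousLinearMap.id ℝ E + a.comp b : E →L[ℝ] E) := by
      rw [injective_iff_map_eq_zero]
      intro v hv
      have hv' : v + a (b v) = 0 := by simpa using hv
      have h1 := hM'.cocoercive hMc v
      have h2 := hg'.cocoercive (c := 0) (by simpa using hgm) (b v)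
      have h3 : v = -a (b v) := eq_neg_of_add_eq_zero_left hv'
      rw [h3, inner_neg_right, real_inner_comm, ← h3] at h1
      have h4 : ‖b v‖ ^ 2 ≤ 0 := by
        by_contra h
        push Not at h
        have := mul_pos hc h
        simp only [zero_mul] at h2
        linarith
      have h5 : b v = 0 := norm_eq_zero.1
        (pow_eq_zero_iff two_ne_zero |>.1 (le_antisymm h4 (sq_nonneg _)))
      rw [h3, h5]; simp
    let e := LinearEquiv.ofInjectiveEndo
      (ContinuousLinearMap.id ℝ E + a.comp b : E →L[ℝ] E).toLinearMap hinj
    refine ⟨e.toContinuousLinearEquiv, ?_⟩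
    have he : (e.toContinuousLinearEquiv : E →L[ℝ] E)
        = ContinuousLinearMap.id ℝ E + a.comp b := by
      ext v; rfl
    rw [he]; exact hd
  have hopen : IsOpen (range T) := by
    rw [isOpen_iff_mem_nhds]
    rintro _ ⟨x, rfl⟩
    obtain ⟨T', hT'⟩ := hder x
    have hs := hTC.contDiffAt.hasStrictFDerivAt' hT' (by norm_num)
    rw [← hs.map_nhds_eq_of_equiv]
    exact Filter.range_mem_map
  have hclosed : IsClosed (range T) := by
    have : IsProperMap T := by
      rw [isProperMap_iff_tendsto_cocompact]
      refine ⟨hTC.continuous, ?_⟩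
      rw [← Metric.cobounded_eq_cocompact, ← tendsto_norm_atTop_iff_cobounded]
      refine tendsto_atTop_mono (f := fun θ : E => ‖θ‖ - B) (fun θ => ?_) ?_
      · have h1 : ‖θ‖ ≤ ‖T θ‖ + ‖g (M θ)‖ := by
          have : θ = T θ - g (M θ) := by simp [hT]
          calc ‖θ‖ = ‖T θ - g (M θ)‖ := by rw [← this]
            _ ≤ _ := norm_sub_le _ _
        linarith [hB (M θ)]
      · exact tendsto_atTop_add_const_right _ _ tendsto_norm_cobounded_atTop
    exact this.isClosedMap.isClosed_range
  have hsurj : Function.Surjective T := by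
    rw [← range_eq_univ]
    exact IsClopen.eq_univ ⟨hclosed, hopen⟩ ⟨T 0, 0, rfl⟩
  choose S hS using hsurj
  refine ⟨S, ?_, hS⟩
  rw [contDiff_iff_contDiffAt]
  intro θ
  obtain ⟨T', hT'⟩ := hder (S θ)
  have hc := hTC.contDiffAt.to_localInverse hT' (by norm_num)
  rw [hS] at hc
  refine hc.congr_of_eventuallyEq ?_
  have hs := hTC.contDiffAt.hasStrictFDerivAt' hT' (by norm_num)
  have := hs.eventually_right_inverse
  rw [hS] at this
  filter_upwards [this] with y hy
  apply hinj
  rw [hS]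
  exact hy.symm

end ConvexGradient

section RadialBarrier

open scoped Topology

/-- A smooth monotone profile on `ℝ` vanishing up to `r`, equal to `A` from `r + ε` on. -/
lemma exists_profile {A r ε : ℝ} (hA : 0 ≤ A) (hε : 0 < ε) :
    ∃ (H φ : ℝ → ℝ) (K : ℝ), 0 ≤ K ∧ (∀ s t, H s + φ s * (t - s) ≤ H t) ∧ ContDiff ℝ 1 φ ∧
      (∀ s, 0 ≤ φ s) ∧ (∀ s, φ s ≤ A) ∧ (∀ s ≤ r, φ s = 0) ∧ (∀ s ≤ r, H s = 0) ∧
      (∀ s, r + ε ≤ s → φ s = A) ∧ ∀ s t, |φ s - φ t| ≤ K * |s - t| := by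
  set φ : ℝ → ℝ := fun s => A * Real.smoothTransition ((s - r) / ε) with hφ
  have hφC : ContDiff ℝ 1 φ :=
    contDiff_const.mul ((Real.smoothTransition.contDiff (n := 1)).comp
      ((contDiff_id.sub contDiff_const).div_const ε))
  have hmono : Monotone φ := fun s t hst => by
    simp only [hφ]
    gcongr
    exact Real.smoothTransition.monotone (by gcongr)
  have hzero : ∀ s ≤ r, φ s = 0 := fun s hs => by
    simp only [hφ]
    rw [Real.smoothTransition.zero_of_nonpos, mul_zero]
    exact div_nonpos_of_nonpos_of_nonneg (by linarith) hε.le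
  obtain ⟨K, hK⟩ : ∃ K : ℝ≥0, LipschitzWith K Real.smoothTransition := by
    obtain ⟨K, hK⟩ := ContDiffOn.exists_lipschitzOnWith
      ((Real.smoothTransition.contDiff (n := 1)).contDiffOn (s := Icc (0 : ℝ) 1)) (by norm_num)
      (convex_Icc 0 1) isCompact_Icc
    refine ⟨K, LipschitzWith.of_dist_le_mul fun x y => ?_⟩
    rw [← Real.smoothTransition.projIcc (x := x), ← Real.smoothTransition.projIcc (x := y)]
    refine (hK.dist_le_mul _ (Subtype.prop _) _ (Subtype.prop _)).trans ?_
    gcongr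
    have := (LipschitzWith.projIcc (zero_le_one (α := ℝ))).dist_le_mul x y
    rw [NNReal.coe_one, one_mul] at this
    exact this
  refine ⟨fun s => ∫ u in r..s, φ u, φ, A * (K * (1 / ε)), by positivity, ?_, hφC,
    fun s => mul_nonneg hA (Real.smoothTransition.nonneg _), fun s => ?_, hzero, ?_, ?_, ?_⟩
  · intro s t
    have hint : ∀ a b, IntervalIntegrable φ volume a b :=
      fun a b => hφC.continuous.intervalIntegrable a b
    have h1 : (∫ u in r..s, φ u) + ∫ u in s..t, φ u = ∫ u in r..t, φ u :=
      intervalIntegral.integral_add_adjacent_intervals (hint _ _) (hint _ _)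
    show (∫ u in r..s, φ u) + _ ≤ ∫ u in r..t, φ u
    rw [← h1]
    gcongr
    rcases le_total s t with hst | hst
    · calc φ s * (t - s) = ∫ _ in s..t, φ s := by
            rw [intervalIntegral.integral_const, smul_eq_mul]; ring
        _ ≤ ∫ u in s..t, φ u := by
            refine intervalIntegral.integral_mono_on hst (by simp) (hint _ _) ?_
            intro u hu
            exact hmono hu.1
    · rw [intervalIntegral.integral_symm]
      have : ∫ u in t..s, φ u ≤ ∫ _ in t..s, φ s := by
        refine intervalIntegral.integral_mono_on hst (hint _ _) (by simp) ?_
        intro u hu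
        exact hmono hu.2
      rw [intervalIntegral.integral_const, smul_eq_mul] at this
      linarith
  · exact mul_le_of_le_one_right hA (Real.smoothTransition.le_one _)
  · intro s hs
    show ∫ u in r..s, φ u = 0
    rw [intervalIntegral.integral_symm, neg_eq_zero]
    rw [intervalIntegral.integral_congr (g := fun _ => (0 : ℝ))]
    · simp
    · intro u hu
      rw [uIcc_of_le hs] at hu
      exact hzero u hu.2
  · intro s hs
    simp only [hφ]
    rw [Real.smoothTransition.one_of_one_le, mul_one]
    rw [le_div_iff₀ hε]; linarith
  · intro s t
    simp only [hφ]
    rw [← mul_sub, abs_mul, abs_of_nonneg hA, mul_assoc]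
    gcongr
    have := hK.dist_le_mul ((s - r) / ε) ((t - r) / ε)
    rw [Real.dist_eq, Real.dist_eq] at this
    have e : (s - r) / ε - (t - r) / ε = 1 / ε * (s - t) := by ring
    rw [e, abs_mul, abs_of_pos (one_div_pos.2 hε)] at this
    linarith

variable {E : Type*} [NormedAddCommGroup E] [InnerProductSpace ℝ E]

/-- The radial extension of a Lipschitz profile vanishing at `0` is Lipschitz. -/
lemma norm_radial_sub_le {φ : ℝ → ℝ} {K : ℝ} (h0 : φ 0 = 0) (hφ : ∀ s, 0 ≤ φ s)
    (hK : ∀ s t, |φ s - φ t| ≤ K * |s - t|) (x y : E) :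
    ‖(φ ‖x‖ / ‖x‖) • x - (φ ‖y‖ / ‖y‖) • y‖ ≤ K * ‖x - y‖ := by
  have hK1 : 0 ≤ K := by
    have := hK 1 0
    simp only [sub_zero, abs_one, mul_one] at this
    exact (abs_nonneg _).trans this
  have hle : ∀ s, 0 ≤ s → φ s ≤ K * s := fun s hs => by
    have := hK s 0
    rwa [h0, sub_zero, sub_zero, abs_of_nonneg hs, abs_of_nonneg (hφ s)] at this
  have hn : ∀ z : E, ‖(φ ‖z‖ / ‖z‖) • z‖ = φ ‖z‖ := fun z => by
    rw [norm_smul, Real.norm_eq_abs, abs_of_nonneg (div_nonneg (hφ _) (norm_nonneg _))]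
    rcases eq_or_ne z 0 with rfl | hz
    · simp [h0]
    · have := norm_ne_zero_iff.2 hz
      field_simp
  rcases eq_or_ne x 0 with rfl | hx
  · rw [smul_zero, zero_sub, norm_neg, hn, zero_sub, norm_neg]
    exact hle _ (norm_nonneg _)
  rcases eq_or_ne y 0 with rfl | hy
  · rw [smul_zero, sub_zero, hn, sub_zero]
    exact hle _ (norm_nonneg _)
  have hx' : 0 < ‖x‖ := norm_pos_iff.2 hx
  have hy' : 0 < ‖y‖ := norm_pos_iff.2 hy
  refine le_of_sq_le_sq ?_ (by positivity)
  rw [norm_sub_sq_real, hn, hn, inner_smul_left, inner_smul_right, mul_pow, norm_sub_sq_real]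
  simp only [conj_trivial]
  set a := ‖x‖
  set b := ‖y‖
  set i := ⟪x, y⟫ with hi
  have hiab : i ≤ a * b := real_inner_le_norm x y
  have h1 : (φ a - φ b) ^ 2 ≤ K ^ 2 * (a - b) ^ 2 := by
    rw [← sq_abs (φ a - φ b), ← sq_abs (a - b), ← mul_pow]
    gcongr
    exact hK a b
  have h2 : φ a / a * (φ b / b) ≤ K * K := by
    gcongr
    · exact div_nonneg (hφ _) hy'.le
    · rw [div_le_iff₀ hx']; exact hle _ hx'.le
    · rw [div_le_iff₀ hy']; exact hle _ hy'.le
  have h3 : φ a / a * (φ b / b) * (a * b - i) ≤ K * K * (a * b - i) :=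
    mul_le_mul_of_nonneg_right h2 (by linarith)
  have h4 : φ a / a * (φ b / b) * (a * b) = φ a * φ b := by field_simp
  nlinarith

/-- A convex function vanishing on a ball, with bounded Lipschitz radial gradient of prescribed
size outside a larger ball. -/
lemma exists_radial_barrier (c : E) {A r ε : ℝ} (hA : 0 ≤ A) (hr : 0 < r) (hε : 0 < ε) :
    ∃ (h : E → ℝ) (g : E → E) (K : ℝ), 0 ≤ K ∧ IsSubgradient h g ∧ ContDiff ℝ 1 g ∧
      (∀ x, ‖g x‖ ≤ A) ∧ (∀ x y, ‖g x - g y‖ ≤ K * ‖x - y‖) ∧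
      (∀ x ∈ Metric.closedBall c r, h x = 0) ∧
      (∀ x, ∃ a : ℝ, 0 ≤ a ∧ g x = a • (x - c)) ∧
      ∀ x, r + ε ≤ ‖x - c‖ → ‖g x‖ = A := by
  obtain ⟨H, φ, K, hK0, hH, hφC, hφ0, hφA, hφz, hHz, hφe, hφK⟩ :=
    exists_profile (r := r) hA hε
  have hn : ∀ z : E, ‖(φ ‖z‖ / ‖z‖) • z‖ = φ ‖z‖ := fun z => by
    rw [norm_smul, Real.norm_eq_abs, abs_of_nonneg (div_nonneg (hφ0 _) (norm_nonneg _))]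
    rcases eq_or_ne z 0 with rfl | hz
    · simp [hφz 0 hr.le]
    · have := norm_ne_zero_iff.2 hz
      field_simp
  have hin : ∀ x y : E, ⟪(φ ‖x‖ / ‖x‖) • x, y - x⟫ ≤ φ ‖x‖ * (‖y‖ - ‖x‖) := fun x y => by
    have h1 : ⟪(φ ‖x‖ / ‖x‖) • x, y⟫ ≤ φ ‖x‖ * ‖y‖ := by
      refine (real_inner_le_norm _ _).trans ?_
      rw [hn]
    have h2 : ⟪(φ ‖x‖ / ‖x‖) • x, x⟫ = φ ‖x‖ * ‖x‖ := by
      rw [inner_smul_left, real_inner_self_eq_norm_sq]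
      simp only [conj_trivial]
      rcases eq_or_ne x 0 with rfl | hz
      · simp
      · have := norm_ne_zero_iff.2 hz
        field_simp
    rw [inner_sub_right]; linarith
  refine ⟨fun x => H ‖x - c‖, fun x => (φ ‖x - c‖ / ‖x - c‖) • (x - c), K, hK0, ?_, ?_, ?_,
    ?_, ?_, ?_, ?_⟩
  · intro x y
    have h1 := hin (x - c) (y - c)
    rw [sub_sub_sub_cancel_right] at h1
    have h2 := hH ‖x - c‖ ‖y - c‖
    show H ‖x - c‖ + _ ≤ H ‖y - c‖
    linarith
  · have : ContDiff ℝ 1 (fun x : E => (φ ‖x‖ / ‖x‖) • x) := by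
      rw [contDiff_iff_contDiffAt]
      intro x
      rcases eq_or_ne x 0 with rfl | hx
      · have : (fun x : E => (φ ‖x‖ / ‖x‖) • x) =ᶠ[𝓝 0] fun _ => 0 := by
          filter_upwards [Metric.ball_mem_nhds (0 : E) hr] with y hy
          rw [hφz _ (mem_ball_zero_iff.1 hy).le]; simp
        exact contDiffAt_const.congr_of_eventuallyEq this
      · have hc : ContDiffAt ℝ 1 (fun x : E => ‖x‖) x := contDiffAt_norm ℝ hx
        exact ((hφC.contDiffAt.comp x hc).div hc (norm_ne_zero_iff.2 hx)).smul contDiffAt_id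
    exact this.comp (contDiff_id.sub contDiff_const)
  · intro x
    rw [hn]; exact hφA _
  · intro x y
    have := norm_radial_sub_le (hφz 0 hr.le) hφ0 hφK (x - c) (y - c)
    rwa [sub_sub_sub_cancel_right] at this
  · intro x hx
    exact hHz _ (by rwa [← mem_closedBall_iff_norm])
  · intro x
    exact ⟨_, div_nonneg (hφ0 _) (norm_nonneg _), rfl⟩
  · intro x hx
    rw [hn]; exact hφe _ hx

end RadialBarrier

section LinearGrowth

variable {E : Type*} [NormedAddCommGroup E] [InnerProductSpace ℝ E]

/-- A subgradient of a function growing slower than every quadratic grows sublinearly. -/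
lemma IsSubgradient.exists_norm_le {F : E → ℝ} {g : E → E} (h : IsSubgradient F g)
    (hF : ∀ δ > 0, ∃ C, ∀ x, F x ≤ δ * ‖x‖ ^ 2 + C) {δ : ℝ} (hδ : 0 < δ) :
    ∃ R, 0 < R ∧ ∀ x, R ≤ ‖x‖ → ‖g x‖ ≤ δ * ‖x‖ := by
  obtain ⟨C, hC⟩ := hF (δ / 8) (by positivity)
  set C₁ := |C - F 0| with hC₁
  refine ⟨max 1 (2 * (C₁ + ‖g 0‖) / δ), by positivity, fun x hx => ?_⟩
  have hx1 : 1 ≤ ‖x‖ := (le_max_left _ _).trans hx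
  have hx2 : 2 * (C₁ + ‖g 0‖) ≤ ‖x‖ * δ := by
    have := (le_max_right _ _).trans hx
    rwa [div_le_iff₀ hδ] at this
  rcases eq_or_ne (g x) 0 with h0 | h0
  · rw [h0, norm_zero]; positivity
  have hg : 0 < ‖g x‖ := norm_pos_iff.2 h0
  set u : E := (‖x‖ / ‖g x‖) • g x with hu
  have hun : ‖u‖ = ‖x‖ := by
    rw [hu, norm_smul, norm_div, norm_norm, norm_norm]; field_simp
  have hgu : ⟪g x, u⟫ = ‖g x‖ * ‖x‖ := by
    rw [hu, inner_smul_right, real_inner_self_eq_norm_sq]; field_simp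
  have h1 := h x (x + u)
  rw [add_sub_cancel_left, hgu] at h1
  have h2 := h 0 x
  rw [sub_zero] at h2
  have h3 : -(‖g 0‖ * ‖x‖) ≤ ⟪g 0, x⟫ := (abs_le.1 (abs_real_inner_le_norm _ _)).1
  have h4 := hC (x + u)
  have h5 : ‖x + u‖ ≤ 2 * ‖x‖ := by
    have := norm_add_le x u
    linarith
  have h6 : ‖x + u‖ ^ 2 ≤ (2 * ‖x‖) ^ 2 := by gcongr
  have h7 : C - F 0 ≤ C₁ := le_abs_self _
  have h8 : C₁ ≤ C₁ * ‖x‖ := le_mul_of_one_le_right (abs_nonneg _) hx1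
  have h9 : ‖g x‖ * ‖x‖ ≤ (δ * ‖x‖) * ‖x‖ := by
    have := mul_le_mul_of_nonneg_right hx2 (norm_nonneg x)
    have := mul_le_mul_of_nonneg_left h6 hδ.le
    nlinarith
  exact le_of_mul_le_mul_right h9 (by linarith)

lemma IsSubgradient.exists_norm_sub_le {F : E → ℝ} {g : E → E} (h : IsSubgradient F g)
    (hF : ∀ δ > 0, ∃ C, ∀ x, F x ≤ δ * ‖x‖ ^ 2 + C) {δ : ℝ} (hδ : 0 < δ) (x₀ y₀ : E) :
    ∃ R, 0 < R ∧ ∀ x, R ≤ ‖x - x₀‖ → ‖g x - y₀‖ ≤ δ * ‖x - x₀‖ := by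
  obtain ⟨R, hR, hgR⟩ := h.exists_norm_le hF (δ := δ / 4) (by positivity)
  refine ⟨R + ‖x₀‖ + 2 * ‖y₀‖ / δ, by positivity, fun x hx => ?_⟩
  have hd : 0 ≤ 2 * ‖y₀‖ / δ := by positivity
  have h1 : ‖x - x₀‖ ≤ ‖x‖ + ‖x₀‖ := norm_sub_le _ _
  have h2 : ‖x‖ ≤ ‖x - x₀‖ + ‖x₀‖ := by simpa using norm_add_le (x - x₀) x₀
  have h3 := hgR x (by linarith)
  have h4 : 2 * ‖y₀‖ ≤ ‖x - x₀‖ * δ := by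
    rw [← div_le_iff₀ hδ]; linarith [norm_nonneg x₀]
  have h5 := norm_sub_le (g x) y₀
  have h6 : δ / 4 * ‖x‖ ≤ δ / 4 * (2 * ‖x - x₀‖) := by
    gcongr; linarith
  linarith

end LinearGrowth

section ExponentialFamily

variable {E : Type*} [NormedAddCommGroup E] [InnerProductSpace ℝ E]

/-- `U` dominates every quadratic. -/
def SuperQuadratic {E : Type*} [NormedAddCommGroup E] (U : E → ℝ) : Prop := ∀ A : ℝ, ∃ C : ℝ, ∀ x, A * ‖x‖ ^ 2 - C ≤ U x

/-- The unnormalised density `exp (-U x + ⟪x, θ⟫)`. -/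
def gibbsWeight (U : E → ℝ) (θ x : E) : ℝ := Real.exp (-U x + ⟪x, θ⟫)

/-- Continuous functions of at most Gaussian growth. -/
def GaussianGrowth {E W : Type*} [NormedAddCommGroup E] [NormedAddCommGroup W] (F : E → W) : Prop :=
  Continuous F ∧ ∃ C A : ℝ, ∀ x, ‖F x‖ ≤ C * Real.exp (A * ‖x‖ ^ 2)

variable {U : E → ℝ} {W : Type*} [NormedAddCommGroup W] [NormedSpace ℝ W]

lemma gibbsWeight_pos (θ x : E) : 0 < gibbsWeight U θ x := Real.exp_pos _

lemma continuous_gibbsWeight (hU : Continuous U) (θ : E) : Continuous (gibbsWeight U θ) := by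
  unfold gibbsWeight; fun_prop

lemma norm_le_exp_sq {E : Type*} [NormedAddCommGroup E] (x : E) : ‖x‖ ≤ Real.exp (1 * ‖x‖ ^ 2) := by
  have := Real.add_one_le_exp (1 * ‖x‖ ^ 2)
  nlinarith [sq_nonneg (‖x‖ - 1), norm_nonneg x]

lemma gibbsWeight_le {θ : E} {t : ℝ} (ht : ‖θ‖ ≤ t) (x : E) :
    gibbsWeight U θ x ≤ Real.exp (t ^ 2) * Real.exp (1 * ‖x‖ ^ 2 - U x) := by
  unfold gibbsWeight
  rw [← Real.exp_add, Real.exp_le_exp]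
  have h1 := real_inner_le_norm x θ
  have h2 : ‖x‖ * ‖θ‖ ≤ ‖x‖ * t := by gcongr
  have h3 := norm_nonneg x
  nlinarith [sq_nonneg (‖x‖ - t), sq_nonneg t, sq_nonneg ‖x‖]

lemma gaussianGrowth_const {E W : Type*} [NormedAddCommGroup E] [NormedAddCommGroup W] (w : W) : GaussianGrowth (fun _ : E => w) :=
  ⟨continuous_const, ‖w‖, 0, fun x => by simp⟩

lemma gaussianGrowth_id {E : Type*} [NormedAddCommGroup E] :
    GaussianGrowth (fun x : E => x) :=
  ⟨continuous_id, 1, 1, fun x => by rw [one_mul]; exact norm_le_exp_sq x⟩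

/-- The derivative of `θ ↦ exp ⟪x, θ⟫ • w`, up to the exponential factor. -/
def innerSmulRight (x : E) (w : W) : E →L[ℝ] W := (innerSL ℝ x).smulRight w

@[simp] lemma innerSmulRight_apply (x : E) (w : W) (v : E) :
    innerSmulRight x w v = ⟪x, v⟫ • w := rfl

lemma GaussianGrowth.innerSmulRight {F : E → W} (hF : GaussianGrowth F) :
    GaussianGrowth (fun x : E => innerSmulRight x (F x)) := by
  obtain ⟨hc, C, A, hC⟩ := hF
  refine ⟨?_, C, 1 + A, fun x => ?_⟩
  · exact ((ContinuousLinearMap.smulRightL ℝ E W).continuous₂).comp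
      (((innerSL ℝ (E := E)).continuous).prodMk hc)
  · have h1 : ‖_root_.innerSmulRight x (F x)‖ = ‖x‖ * ‖F x‖ := by
      unfold _root_.innerSmulRight
      rw [ContinuousLinearMap.norm_smulRight_apply, innerSL_apply_norm]
    rw [h1]
    calc ‖x‖ * ‖F x‖ ≤ Real.exp (1 * ‖x‖ ^ 2) * (C * Real.exp (A * ‖x‖ ^ 2)) :=
          mul_le_mul (norm_le_exp_sq x) (hC x) (norm_nonneg _) (by positivity)
      _ = _ := by rw [add_mul, Real.exp_add]; ring

variable [FiniteDimensional ℝ E] [MeasurableSpace E] [BorelSpace E]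

/-- The partition function. -/
def partitionFn (U : E → ℝ) (θ : E) : ℝ := ∫ x, gibbsWeight U θ x

/-- The mean of the Gibbs measure with tilt `θ`. -/
def gibbsMean (U : E → ℝ) (θ : E) : E :=
  (partitionFn U θ)⁻¹ • ∫ x, gibbsWeight U θ x • x

lemma integrable_exp_sq_sub (hU : Continuous U) (hsq : SuperQuadratic U) (A : ℝ) :
    Integrable (fun x => Real.exp (A * ‖x‖ ^ 2 - U x)) := by
  obtain ⟨C, hC⟩ := hsq (A + 1)
  have hG : Integrable (fun x : E => Real.exp (-‖x‖ ^ 2)) := by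
    have := (GaussianFourier.integrable_cexp_neg_mul_sq_norm_add (V := E) (b := 1)
      (by simp) 0 0).norm
    refine this.congr (Eventually.of_forall fun x => ?_)
    simp only [Complex.norm_exp]
    congr 1
    simp [← Complex.ofReal_pow]
  refine (hG.const_mul (Real.exp C)).mono' (by fun_prop) (Eventually.of_forall fun x => ?_)
  rw [Real.norm_eq_abs, Real.abs_exp, ← Real.exp_add]
  gcongr
  have := hC x
  linarith

/-- A domination of the weighted integrand, uniform for tilts in a ball. -/
lemma GaussianGrowth.exists_bound {W : Type*} [NormedAddCommGroup W] {F : E → W} (hF : GaussianGrowth F) (hU : Continuous U)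
    (hsq : SuperQuadratic U) (t : ℝ) :
    ∃ b : E → ℝ, Integrable b ∧ ∀ θ, ‖θ‖ ≤ t → ∀ x, gibbsWeight U θ x * ‖F x‖ ≤ b x := by
  obtain ⟨-, C, A, hC⟩ := hF
  refine ⟨fun x => Real.exp (t ^ 2) * C * Real.exp ((1 + A) * ‖x‖ ^ 2 - U x),
    (integrable_exp_sq_sub hU hsq _).const_mul _, fun θ hθ x => ?_⟩
  calc gibbsWeight U θ x * ‖F x‖
      ≤ (Real.exp (t ^ 2) * Real.exp (1 * ‖x‖ ^ 2 - U x)) * (C * Real.exp (A * ‖x‖ ^ 2)) :=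
        mul_le_mul (gibbsWeight_le hθ x) (hC x) (norm_nonneg _) (by positivity)
    _ = Real.exp (t ^ 2) * C * Real.exp ((1 + A) * ‖x‖ ^ 2 - U x) := by
        rw [show (1 + A) * ‖x‖ ^ 2 - U x = (1 * ‖x‖ ^ 2 - U x) + A * ‖x‖ ^ 2 by ring,
          Real.exp_add]
        ring

lemma GaussianGrowth.integrable {F : E → W} (hF : GaussianGrowth F) (hU : Continuous U)
    (hsq : SuperQuadratic U) (θ : E) : Integrable (fun x => gibbsWeight U θ x • F x) := by
  obtain ⟨b, hb, hle⟩ := hF.exists_bound hU hsq ‖θ‖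
  refine hb.mono' ?_ (Eventually.of_forall fun x => ?_)
  · exact ((continuous_gibbsWeight hU θ).smul hF.1).aestronglyMeasurable
  · rw [norm_smul, Real.norm_eq_abs, abs_of_pos (gibbsWeight_pos θ x)]
    exact hle θ le_rfl x

lemma hasFDerivAt_gibbsMoment {F : E → W} (hF : GaussianGrowth F) (hU : Continuous U)
    (hsq : SuperQuadratic U) (θ : E) :
    HasFDerivAt (fun θ => ∫ x, gibbsWeight U θ x • F x)
      (∫ x, gibbsWeight U θ x • innerSmulRight x (F x)) θ := by
  obtain ⟨b, hb, hle⟩ := hF.innerSmulRight.exists_bound hU hsq (‖θ‖ + 1)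
  refine hasFDerivAt_integral_of_dominated_of_fderiv_le
    (F := fun θ x => gibbsWeight U θ x • F x)
    (F' := fun θ x => gibbsWeight U θ x • innerSmulRight x (F x)) (bound := b)
    (Metric.ball_mem_nhds θ one_pos) ?_ (hF.integrable hU hsq θ) ?_ ?_ hb ?_
  · exact Eventually.of_forall fun θ => (hF.integrable hU hsq θ).aestronglyMeasurable
  · exact (hF.innerSmulRight.integrable hU hsq θ).aestronglyMeasurable
  · refine Eventually.of_forall fun x θ' hθ' => ?_
    rw [norm_smul, Real.norm_eq_abs, abs_of_pos (gibbsWeight_pos θ' x)]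
    refine hle θ' ?_ x
    have : ‖θ' - θ‖ < 1 := by rwa [← mem_ball_iff_norm]
    have h2 : ‖θ'‖ ≤ ‖θ' - θ‖ + ‖θ‖ := by simpa using norm_add_le (θ' - θ) θ
    linarith
  · refine Eventually.of_forall fun x θ' _ => ?_
    have h1 : HasFDerivAt (fun θ : E => -U x + ⟪x, θ⟫) (innerSL ℝ x) θ' :=
      ((innerSL ℝ x).hasFDerivAt).const_add (-U x)
    have h2 := h1.exp.smul_const (F x)
    refine h2.congr_fderiv ?_
    ext v
    simp [gibbsWeight, innerSmulRight, mul_smul]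

lemma contDiff_gibbsMoment {F : E → W} (hF : GaussianGrowth F) (hU : Continuous U)
    (hsq : SuperQuadratic U) : ContDiff ℝ 1 (fun θ => ∫ x, gibbsWeight U θ x • F x) := by
  have hd := fun θ => hasFDerivAt_gibbsMoment hF hU hsq θ
  rw [contDiff_one_iff_fderiv]
  refine ⟨fun θ => (hd θ).differentiableAt, ?_⟩
  have : fderiv ℝ (fun θ => ∫ x, gibbsWeight U θ x • F x)
      = fun θ => ∫ x, gibbsWeight U θ x • innerSmulRight x (F x) :=
    funext fun θ => (hd θ).fderiv
  rw [this, continuous_iff_continuousAt]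
  exact fun θ => (hasFDerivAt_gibbsMoment hF.innerSmulRight hU hsq θ).continuousAt

lemma integrable_gibbsWeight (hU : Continuous U) (hsq : SuperQuadratic U) (θ : E) :
    Integrable (gibbsWeight U θ) := by
  simpa using (gaussianGrowth_const (E := E) (1 : ℝ)).integrable hU hsq θ

lemma partitionFn_pos (hU : Continuous U) (hsq : SuperQuadratic U) (θ : E) :
    0 < partitionFn U θ :=
  integral_pos_of_integrable_nonneg_nonzero (x := 0) (continuous_gibbsWeight hU θ)
    (integrable_gibbsWeight hU hsq θ) (fun x => (gibbsWeight_pos θ x).le)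
    (gibbsWeight_pos θ 0).ne'

lemma partitionFn_smul_gibbsMean (hU : Continuous U) (hsq : SuperQuadratic U) (θ : E) :
    partitionFn U θ • gibbsMean U θ = ∫ x, gibbsWeight U θ x • x :=
  smul_inv_smul₀ (partitionFn_pos hU hsq θ).ne' _

lemma contDiff_partitionFn (hU : Continuous U) (hsq : SuperQuadratic U) :
    ContDiff ℝ 1 (partitionFn U) := by
  have := contDiff_gibbsMoment (gaussianGrowth_const (E := E) (1 : ℝ)) hU hsq
  simp only [smul_eq_mul, mul_one] at this
  exact this

lemma contDiff_gibbsMean (hU : Continuous U) (hsq : SuperQuadratic U) :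
    ContDiff ℝ 1 (gibbsMean U) :=
  ((contDiff_partitionFn hU hsq).inv fun θ => (partitionFn_pos hU hsq θ).ne').smul
    (contDiff_gibbsMoment gaussianGrowth_id hU hsq)

end ExponentialFamily

section CovarianceBound

section GrowthClosure

variable {E : Type*} [NormedAddCommGroup E] {W : Type*} [NormedAddCommGroup W]

lemma GaussianGrowth.norm {F : E → W} (hF : GaussianGrowth F) :
    GaussianGrowth (fun x => ‖F x‖) := by
  obtain ⟨hc, C, A, h⟩ := hF
  exact ⟨hc.norm, C, A, fun x => by rw [norm_norm]; exact h x⟩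

lemma GaussianGrowth.smul [NormedSpace ℝ W] {f : E → ℝ} {F : E → W} (hf : GaussianGrowth f)
    (hF : GaussianGrowth F) : GaussianGrowth (fun x => f x • F x) := by
  obtain ⟨hc, C, A, h⟩ := hf
  obtain ⟨hc', C', A', h'⟩ := hF
  refine ⟨hc.smul hc', C * C', A + A', fun x => ?_⟩
  rw [norm_smul, add_mul, Real.exp_add]
  calc ‖f x‖ * ‖F x‖ ≤ (C * Real.exp (A * ‖x‖ ^ 2)) * (C' * Real.exp (A' * ‖x‖ ^ 2)) :=
        mul_le_mul (h x) (h' x) (norm_nonneg _) ((norm_nonneg _).trans (h x))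
    _ = _ := by ring

lemma gaussianGrowth_sub_const (c : E) : GaussianGrowth (fun x : E => x - c) := by
  refine ⟨by fun_prop, 1 + ‖c‖, 1, fun x => ?_⟩
  have h1 := norm_sub_le x c
  have h2 := norm_le_exp_sq x
  have h3 : 1 ≤ Real.exp (1 * ‖x‖ ^ 2) := Real.one_le_exp (by positivity)
  nlinarith [norm_nonneg c]

lemma GaussianGrowth.inner_const [InnerProductSpace ℝ E] {F : E → E} (hF : GaussianGrowth F)
    (v : E) : GaussianGrowth (fun x => ⟪F x, v⟫) := by
  obtain ⟨hc, C, A, h⟩ := hF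
  refine ⟨by fun_prop, C * ‖v‖, A, fun x => (norm_inner_le_norm _ _).trans ?_⟩
  calc ‖F x‖ * ‖v‖ ≤ (C * Real.exp (A * ‖x‖ ^ 2)) * ‖v‖ := by gcongr; exact h x
    _ = _ := by ring

lemma gaussianGrowth_norm_sub_sq (c : E) : GaussianGrowth (fun x : E => ‖x - c‖ ^ 2) := by
  simpa [sq] using (gaussianGrowth_sub_const c).norm.smul (gaussianGrowth_sub_const c).norm

end GrowthClosure

variable {E : Type*} [NormedAddCommGroup E] [InnerProductSpace ℝ E] [FiniteDimensional ℝ E]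
  [MeasurableSpace E] [BorelSpace E] {U : E → ℝ}

/-- Gibbs measures of a strongly convex potential, up to a bounded error, have second moments
about a suitable centre bounded independently of the tilt. -/
lemma exists_secondMoment_le (hU : Continuous U) (hsq : SuperQuadratic U) {c B : ℝ} (hc : 0 < c)
    (hmid : ∀ x y, U ((1 / 2 : ℝ) • (x + y)) ≤ (U x + U y) / 2 - c * ‖x - y‖ ^ 2 + B) :
    ∃ K, 0 < K ∧ ∀ θ, ∃ x₀, ∫ x, gibbsWeight U θ x * ‖x - x₀‖ ^ 2 ≤ K * partitionFn U θ := by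
  set n := Module.finrank ℝ E
  refine ⟨Real.exp (2 * B + 1) / (2 * c) * 2 ^ n, by positivity, fun θ => ?_⟩
  set Uθ : E → ℝ := fun x => U x - ⟪x, θ⟫ with hUθ
  have hbdd : BddBelow (range Uθ) := by
    obtain ⟨C, hC⟩ := hsq 1
    refine ⟨-C - ‖θ‖ ^ 2, ?_⟩
    rintro _ ⟨x, rfl⟩
    have h1 := hC x
    have h2 := real_inner_le_norm x θ
    simp only [hUθ]
    nlinarith [sq_nonneg (‖x‖ - ‖θ‖), sq_nonneg ‖x‖, sq_nonneg ‖θ‖]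
  obtain ⟨x₀, hx₀⟩ : ∃ x₀, Uθ x₀ < (⨅ x, Uθ x) + 1 :=
    exists_lt_of_ciInf_lt (lt_add_one _)
  have hmid' : ∀ x, Uθ ((1 / 2 : ℝ) • (x + x₀)) + 2 * c * ‖x - x₀‖ ^ 2 - 2 * B - 1 ≤ Uθ x := by
    intro x
    have h1 := hmid x x₀
    have h2 : Uθ x₀ < Uθ ((1 / 2 : ℝ) • (x + x₀)) + 1 :=
      hx₀.trans_le (by gcongr; exact ciInf_le hbdd _)
    have h3 : ⟪(1 / 2 : ℝ) • (x + x₀), θ⟫ = (⟪x, θ⟫ + ⟪x₀, θ⟫) / 2 := by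
      rw [inner_smul_left, inner_add_left]; simp; ring
    simp only [hUθ] at h2 ⊢
    rw [h3] at h2 ⊢
    linarith
  have hp : ∀ x, gibbsWeight U θ x = Real.exp (-Uθ x) := fun x => by
    simp only [gibbsWeight, hUθ]; congr 1; ring
  set q : E → ℝ := fun y => gibbsWeight U θ (y + (1 / 2 : ℝ) • x₀) with hq
  have hqi : ∫ y, q ((1 / 2 : ℝ) • y) = 2 ^ n * partitionFn U θ := by
    rw [Measure.integral_comp_smul volume q (1 / 2 : ℝ), hq,
      integral_add_right_eq_self (gibbsWeight U θ) ((1 / 2 : ℝ) • x₀)]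
    simp [n, partitionFn]
  have hqint : Integrable (fun y => q ((1 / 2 : ℝ) • y)) :=
    ((integrable_gibbsWeight hU hsq θ).comp_add_right _).comp_smul (by norm_num)
  refine ⟨x₀, ?_⟩
  calc ∫ x, gibbsWeight U θ x * ‖x - x₀‖ ^ 2
      ≤ ∫ x, Real.exp (2 * B + 1) / (2 * c) * q ((1 / 2 : ℝ) • x) := by
        refine integral_mono ((gaussianGrowth_norm_sub_sq x₀).integrable hU hsq θ)
          (hqint.const_mul _) fun x => ?_
        simp only [hq]
        rw [← smul_add, hp, hp]
        set a := Uθ ((1 / 2 : ℝ) • (x + x₀))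
        set s := ‖x - x₀‖ ^ 2 with hs
        have h1 : 2 * c * s ≤ Real.exp (2 * c * s) := by
          have := Real.add_one_le_exp (2 * c * s); linarith
        calc Real.exp (-Uθ x) * s
            ≤ Real.exp (-(a + 2 * c * s - 2 * B - 1)) * (Real.exp (2 * c * s) / (2 * c)) := by
              refine mul_le_mul (Real.exp_le_exp.2 (neg_le_neg (hmid' x))) ?_ (by positivity)
                (by positivity)
              rw [le_div_iff₀ (by positivity)]; linarith
          _ = Real.exp (2 * B + 1) / (2 * c) * Real.exp (-a) := by
              rw [show -(a + 2 * c * s - 2 * B - 1) = (2 * B + 1) + (-a) + -(2 * c * s) by ring,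
                Real.exp_add, Real.exp_add, Real.exp_neg (2 * c * s)]
              field_simp
    _ = _ := by rw [integral_const_mul, hqi]; ring

lemma integral_gibbsWeight_smul_sub_gibbsMean (hU : Continuous U) (hsq : SuperQuadratic U)
    (θ : E) : ∫ x, gibbsWeight U θ x • (x - gibbsMean U θ) = 0 := by
  simp only [smul_sub]
  rw [integral_sub (gaussianGrowth_id.integrable hU hsq θ)
    ((gaussianGrowth_const _).integrable hU hsq θ), integral_smul_const,
    ← partitionFn_smul_gibbsMean hU hsq θ]
  exact sub_self _

/-- The derivative of the mean is the covariance operator. -/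
lemma partitionFn_smul_fderiv_gibbsMean (hU : Continuous U) (hsq : SuperQuadratic U) (θ v : E) :
    partitionFn U θ • fderiv ℝ (gibbsMean U) θ v
      = ∫ x, gibbsWeight U θ x • ⟪x - gibbsMean U θ, v⟫ • (x - gibbsMean U θ) := by
  set m := gibbsMean U θ with hm
  have hM : HasFDerivAt (gibbsMean U) (fderiv ℝ (gibbsMean U) θ) θ :=
    ((contDiff_gibbsMean hU hsq).differentiable (by norm_num) θ).hasFDerivAt
  have hZ := hasFDerivAt_gibbsMoment (gaussianGrowth_const (E := E) (1 : ℝ)) hU hsq θ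
  simp only [smul_eq_mul, mul_one] at hZ
  have hN := hasFDerivAt_gibbsMoment (gaussianGrowth_id (E := E)) hU hsq θ
  have hN' : HasFDerivAt (fun θ => partitionFn U θ • gibbsMean U θ) _ θ :=
    HasFDerivAt.smul (c := partitionFn U) hZ hM
  simp only [partitionFn_smul_gibbsMean hU hsq] at hN'
  have h := congrArg (fun φ : E →L[ℝ] E => φ v) (hN'.unique hN)
  have hi1 := (gaussianGrowth_const (E := E) (1 : ℝ)).innerSmulRight.integrable hU hsq θ
  have hi2 := (gaussianGrowth_id (E := E)).innerSmulRight.integrable hU hsq θ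
  simp only [add_apply, smul_apply,
    ContinuousLinearMap.smulRight_apply] at h
  rw [ContinuousLinearMap.integral_apply hi1, ContinuousLinearMap.integral_apply hi2] at h
  simp only [smul_apply, innerSmulRight_apply, smul_eq_mul, mul_one] at h
  rw [← hm] at h
  have hxv := ((gaussianGrowth_id (E := E)).inner_const v)
  have hA := (hxv.smul gaussianGrowth_id).integrable hU hsq θ
  have hB := (hxv.smul (gaussianGrowth_const m)).integrable hU hsq θ
  have hC := (gaussianGrowth_sub_const m).integrable hU hsq θ
  have key : ∀ x, gibbsWeight U θ x • ⟪x - m, v⟫ • (x - m)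
      = (gibbsWeight U θ x • ⟪x, v⟫ • x - gibbsWeight U θ x • ⟪x, v⟫ • m)
        - ⟪m, v⟫ • gibbsWeight U θ x • (x - m) := by
    intro x
    rw [inner_sub_left]
    module
  simp only [key]
  have hAB : Integrable (fun x => gibbsWeight U θ x • ⟪x, v⟫ • x
      - gibbsWeight U θ x • ⟪x, v⟫ • m) := hA.sub hB
  have hC' : Integrable (fun x => ⟪m, v⟫ • gibbsWeight U θ x • (x - m)) := hC.smul _
  rw [integral_sub hAB hC', integral_sub hA hB, integral_smul,
    integral_gibbsWeight_smul_sub_gibbsMean hU hsq θ, smul_zero, sub_zero]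
  rw [← h]
  simp only [← smul_assoc]
  rw [integral_smul_const]
  simp only [smul_eq_mul]
  exact (add_sub_cancel_right _ _).symm

lemma integral_norm_sub_gibbsMean_sq_le (hU : Continuous U) (hsq : SuperQuadratic U)
    (θ c : E) : ∫ x, gibbsWeight U θ x * ‖x - gibbsMean U θ‖ ^ 2
      ≤ ∫ x, gibbsWeight U θ x * ‖x - c‖ ^ 2 := by
  set m := gibbsMean U θ with hm
  have hC := (gaussianGrowth_sub_const m).integrable hU hsq θ
  have h0 : ∫ x, ⟪m - c, gibbsWeight U θ x • (x - m)⟫ = 0 := by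
    rw [integral_inner hC, integral_gibbsWeight_smul_sub_gibbsMean hU hsq θ, inner_zero_right]
  have hi := (hC.const_inner (𝕜 := ℝ) (m - c)).const_mul 2
  have hm2 : Integrable (fun x => gibbsWeight U θ x * ‖x - m‖ ^ 2) :=
    (gaussianGrowth_norm_sub_sq m).integrable hU hsq θ
  calc ∫ x, gibbsWeight U θ x * ‖x - m‖ ^ 2
      = ∫ x, (gibbsWeight U θ x * ‖x - m‖ ^ 2
          + 2 * ⟪m - c, gibbsWeight U θ x • (x - m)⟫) := by
        rw [integral_add hm2 hi, integral_const_mul, h0, mul_zero, add_zero]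
    _ ≤ _ := by
        refine integral_mono (hm2.add hi) ((gaussianGrowth_norm_sub_sq c).integrable hU hsq θ)
          fun x => ?_
        have h1 : ‖x - c‖ ^ 2 = ‖x - m‖ ^ 2 + 2 * ⟪m - c, x - m⟫ + ‖m - c‖ ^ 2 := by
          rw [← sub_add_sub_cancel x m c, norm_add_sq_real, real_inner_comm]
        beta_reduce
        rw [h1, inner_smul_right]
        have := mul_nonneg (gibbsWeight_pos (U := U) θ x).le (sq_nonneg ‖m - c‖)
        linarith

/-- The mean of the Gibbs measure is a Lipschitz function of the tilt. -/
lemma exists_lipschitz_gibbsMean (hU : Continuous U) (hsq : SuperQuadratic U) {c B : ℝ}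
    (hc : 0 < c)
    (hmid : ∀ x y, U ((1 / 2 : ℝ) • (x + y)) ≤ (U x + U y) / 2 - c * ‖x - y‖ ^ 2 + B) :
    ∃ K, 0 < K ∧ ∀ x y, ‖gibbsMean U x - gibbsMean U y‖ ≤ K * ‖x - y‖ := by
  obtain ⟨K, hK, h⟩ := exists_secondMoment_le hU hsq hc hmid
  refine ⟨K, hK, fun x y => ?_⟩
  refine convex_univ.norm_image_sub_le_of_norm_fderiv_le (𝕜 := ℝ) (f := gibbsMean U)
    (fun θ _ => (contDiff_gibbsMean hU hsq).differentiable (by norm_num) θ) (fun θ _ => ?_)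
    (mem_univ y) (mem_univ x)
  refine ContinuousLinearMap.opNorm_le_bound _ hK.le fun v => ?_
  obtain ⟨x₀, hx₀⟩ := h θ
  have hZ := partitionFn_pos hU hsq θ
  set m := gibbsMean U θ with hm
  have hm2 : Integrable (fun x => gibbsWeight U θ x * ‖x - m‖ ^ 2) :=
    (gaussianGrowth_norm_sub_sq m).integrable hU hsq θ
  have h1 : partitionFn U θ * ‖fderiv ℝ (gibbsMean U) θ v‖ ≤ partitionFn U θ * (K * ‖v‖) :=
    calc partitionFn U θ * ‖fderiv ℝ (gibbsMean U) θ v‖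
        = ‖∫ x, gibbsWeight U θ x • ⟪x - m, v⟫ • (x - m)‖ := by
          rw [← partitionFn_smul_fderiv_gibbsMean hU hsq, norm_smul, Real.norm_eq_abs,
            abs_of_pos hZ]
      _ ≤ ∫ x, gibbsWeight U θ x * ‖x - m‖ ^ 2 * ‖v‖ := by
          refine norm_integral_le_of_norm_le (hm2.mul_const _) (Eventually.of_forall fun x => ?_)
          rw [norm_smul, norm_smul, Real.norm_eq_abs, abs_of_pos (gibbsWeight_pos θ x)]
          calc gibbsWeight U θ x * (‖⟪x - m, v⟫‖ * ‖x - m‖)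
              ≤ gibbsWeight U θ x * ((‖x - m‖ * ‖v‖) * ‖x - m‖) := by
                gcongr
                · exact (gibbsWeight_pos θ x).le
                · exact norm_inner_le_norm _ _
            _ = _ := by ring
      _ = (∫ x, gibbsWeight U θ x * ‖x - m‖ ^ 2) * ‖v‖ := integral_mul_const _ _
      _ ≤ (K * partitionFn U θ) * ‖v‖ := by
          gcongr
          exact (integral_norm_sub_gibbsMean_sq_le hU hsq θ x₀).trans hx₀
      _ = _ := by ring
  exact le_of_mul_le_mul_left h1 hZ

/-- The log-partition function grows slower than every quadratic. -/
lemma exists_log_partitionFn_le (hU : Continuous U) (hsq : SuperQuadratic U) {δ : ℝ}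
    (hδ : 0 < δ) : ∃ C, ∀ θ, Real.log (partitionFn U θ) ≤ δ * ‖θ‖ ^ 2 + C := by
  set A := 1 / (4 * δ) with hA
  have hi := integrable_exp_sq_sub hU hsq A
  refine ⟨Real.log (∫ x, Real.exp (A * ‖x‖ ^ 2 - U x)), fun θ => ?_⟩
  have h1 : partitionFn U θ
      ≤ Real.exp (δ * ‖θ‖ ^ 2) * ∫ x, Real.exp (A * ‖x‖ ^ 2 - U x) := by
    rw [← integral_const_mul]
    refine integral_mono (integrable_gibbsWeight hU hsq θ) (hi.const_mul _) fun x => ?_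
    simp only [gibbsWeight]
    rw [← Real.exp_add, Real.exp_le_exp]
    have h2 := real_inner_le_norm x θ
    have h3 : ‖x‖ * ‖θ‖ ≤ δ * ‖θ‖ ^ 2 + A * ‖x‖ ^ 2 := by
      have : δ * ‖θ‖ ^ 2 + A * ‖x‖ ^ 2 - ‖x‖ * ‖θ‖ = δ * (‖θ‖ - ‖x‖ / (2 * δ)) ^ 2 := by
        rw [hA]; field_simp; ring
      have := mul_nonneg hδ.le (sq_nonneg (‖θ‖ - ‖x‖ / (2 * δ)))
      linarith
    linarith
  have hpos : 0 < ∫ x, Real.exp (A * ‖x‖ ^ 2 - U x) := by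
    have := (partitionFn_pos hU hsq θ).trans_le h1
    exact pos_of_mul_pos_right this (Real.exp_pos _).le
  calc Real.log (partitionFn U θ) ≤ _ := Real.log_le_log (partitionFn_pos hU hsq θ) h1
    _ = _ := by rw [Real.log_mul (Real.exp_pos _).ne' hpos.ne', Real.log_exp]

end CovarianceBound

section FreeEnergy

variable {d : ℕ} {U h : Euc d → ℝ} {ρ : Euc d → ℝ}

lemma AdmissibleDensity.integrable (hρ : AdmissibleDensity U ρ) : Integrable ρ :=
  .of_integral_ne_zero (by rw [hρ.total]; exact one_ne_zero)

lemma AdmissibleDensity.integrable_smul (hρ : AdmissibleDensity U ρ) :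
    Integrable (fun x => ρ x • x) := by
  refine (hρ.integrable.add hρ.mom2).mono'
    (hρ.meas.smul measurable_id).aestronglyMeasurable (Eventually.of_forall fun x => ?_)
  rw [norm_smul, Real.norm_eq_abs, abs_of_nonneg (hρ.nonneg x), Pi.add_apply]
  nlinarith [hρ.nonneg x, mul_nonneg (hρ.nonneg x) (sq_nonneg (‖x‖ - 1)),
    mul_nonneg (hρ.nonneg x) (sq_nonneg ‖x‖)]

lemma AdmissibleDensity.integrable_inner (hρ : AdmissibleDensity U ρ) (θ : Euc d) :
    Integrable (fun x => ρ x * ⟪x, θ⟫) := by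
  simpa [inner_smul_left] using hρ.integrable_smul.inner_const (𝕜 := ℝ) θ

lemma AdmissibleDensity.integral_inner (hρ : AdmissibleDensity U ρ) (θ : Euc d) :
    ∫ x, ρ x * ⟪x, θ⟫ = ⟪densMean ρ, θ⟫ := by
  rw [densMean, real_inner_comm, ← _root_.integral_inner hρ.integrable_smul]
  simp only [inner_smul_right, real_inner_comm]

/-- The sum of the potential energy and the (negative) entropy of a density. -/
def internalEnergy (U ρ : Euc d → ℝ) : ℝ :=
  (∫ x, ρ x * U x) + ∫ x, ρ x * Real.log (ρ x)

lemma AdmissibleDensity.freeEnergy_eq (hρ : AdmissibleDensity U ρ) (θ : Euc d) :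
    freeEnergy U h θ ρ = internalEnergy U ρ - ⟪densMean ρ, θ⟫ + h (densMean ρ) := by
  simp only [freeEnergy, internalEnergy, mul_sub]
  rw [integral_sub hρ.energy (hρ.integrable_inner θ), hρ.integral_inner]
  ring

/-- The normalised Gibbs density. -/
def gibbsDensity (U : Euc d → ℝ) (θ x : Euc d) : ℝ := gibbsWeight U θ x / partitionFn U θ

lemma gibbsDensity_pos (hU : Continuous U) (hsq : SuperQuadratic U) (θ x : Euc d) :
    0 < gibbsDensity U θ x := div_pos (gibbsWeight_pos θ x) (partitionFn_pos hU hsq θ)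

lemma integrable_gibbsDensity (hU : Continuous U) (hsq : SuperQuadratic U) (θ : Euc d) :
    Integrable (gibbsDensity U θ) := (integrable_gibbsWeight hU hsq θ).div_const _

lemma integral_gibbsDensity (hU : Continuous U) (hsq : SuperQuadratic U) (θ : Euc d) :
    ∫ x, gibbsDensity U θ x = 1 := by
  simp only [gibbsDensity]
  rw [integral_div]
  exact div_self (partitionFn_pos hU hsq θ).ne'

lemma log_gibbsDensity (hU : Continuous U) (hsq : SuperQuadratic U) (θ x : Euc d) :
    Real.log (gibbsDensity U θ x) = -U x + ⟪x, θ⟫ - Real.log (partitionFn U θ) := by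
  rw [gibbsDensity, Real.log_div (gibbsWeight_pos θ x).ne' (partitionFn_pos hU hsq θ).ne',
    gibbsWeight, Real.log_exp]

/-- The Gibbs variational inequality. -/
lemma AdmissibleDensity.inner_densMean_sub_log_partitionFn_le (hU : Continuous U)
    (hsq : SuperQuadratic U) (hρ : AdmissibleDensity U ρ) (θ : Euc d) :
    ⟪densMean ρ, θ⟫ - Real.log (partitionFn U θ) ≤ internalEnergy U ρ := by
  set z := Real.log (partitionFn U θ) with hz
  have hi1 : Integrable (fun x => ρ x * U x + ρ x * Real.log (ρ x)) := hρ.energy.add hρ.ent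
  have hi2 : Integrable (fun x => ρ x * U x + ρ x * Real.log (ρ x) - ρ x * ⟪x, θ⟫) :=
    hi1.sub (hρ.integrable_inner θ)
  have h1 : ∫ x, (ρ x - gibbsDensity U θ x)
      ≤ ∫ x, (ρ x * U x + ρ x * Real.log (ρ x) - ρ x * ⟪x, θ⟫ + ρ x * z) := by
    refine integral_mono (hρ.integrable.sub (integrable_gibbsDensity hU hsq θ))
      (hi2.add (hρ.integrable.mul_const z)) fun x => ?_
    beta_reduce
    have hq := gibbsDensity_pos hU hsq θ x
    rcases (hρ.nonneg x).eq_or_lt with h0 | h0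
    · rw [← h0]; linarith
    · have h2 := Real.log_le_sub_one_of_pos (div_pos hq h0)
      rw [Real.log_div hq.ne' h0.ne', log_gibbsDensity hU hsq] at h2
      have h3 := mul_le_mul_of_nonneg_left h2 h0.le
      rw [mul_sub (ρ x) (_ / _), mul_div_cancel₀ _ h0.ne'] at h3
      linarith
  rw [integral_sub hρ.integrable (integrable_gibbsDensity hU hsq θ), hρ.total,
    integral_gibbsDensity hU hsq, integral_add hi2 (hρ.integrable.mul_const z),
    integral_sub hi1 (hρ.integrable_inner θ),
    integral_add hρ.energy hρ.ent, hρ.integral_inner, integral_mul_const, hρ.total] at h1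
  rw [internalEnergy]
  linarith

lemma integrable_gibbsWeight_mul_self (hU : Continuous U) (hsq : SuperQuadratic U) (θ : Euc d) :
    Integrable (fun x => gibbsWeight U θ x * U x) := by
  obtain ⟨C, hC⟩ := hsq 0
  have hU2 : Continuous (fun x => U x / 2) := by fun_prop
  have hsq2 : SuperQuadratic (fun x => U x / 2) := fun A => by
    obtain ⟨C, hC⟩ := hsq (2 * A)
    exact ⟨C / 2, fun x => by linarith [hC x]⟩
  refine (((integrable_gibbsWeight hU2 hsq2 θ).const_mul 2).add
    ((integrable_gibbsWeight hU hsq θ).const_mul |C|)).mono'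
    ((continuous_gibbsWeight hU θ).mul hU).aestronglyMeasurable
    (Eventually.of_forall fun x => ?_)
  have hw := gibbsWeight_pos (U := U) θ x
  have h1 : gibbsWeight (fun x => U x / 2) θ x = gibbsWeight U θ x * Real.exp (U x / 2) := by
    rw [gibbsWeight, gibbsWeight, ← Real.exp_add]; congr 1; ring
  have h2 : |U x| ≤ 2 * Real.exp (U x / 2) + |C| := by
    have h3 := Real.add_one_le_exp (U x / 2)
    have h4 := Real.exp_pos (U x / 2)
    have h5 := hC x
    rw [abs_le]
    constructor <;> linarith [le_abs_self C, abs_nonneg C]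
  rw [norm_mul, Real.norm_eq_abs, Real.norm_eq_abs, abs_of_pos hw, Pi.add_apply, h1]
  calc gibbsWeight U θ x * |U x| ≤ gibbsWeight U θ x * (2 * Real.exp (U x / 2) + |C|) := by gcongr
    _ = _ := by ring

lemma admissibleDensity_gibbsDensity (hU : Continuous U) (hsq : SuperQuadratic U) (θ : Euc d) :
    AdmissibleDensity U (gibbsDensity U θ) := by
  have hE : Integrable (fun x => gibbsDensity U θ x * U x) := by
    simpa only [gibbsDensity, div_mul_eq_mul_div] using
      (integrable_gibbsWeight_mul_self hU hsq θ).div_const (partitionFn U θ)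
  have hI : Integrable (fun x => gibbsDensity U θ x * ⟪x, θ⟫) := by
    simpa only [gibbsDensity, div_mul_eq_mul_div, smul_eq_mul] using
      ((gaussianGrowth_id.inner_const θ).integrable hU hsq θ).div_const (partitionFn U θ)
  refine ⟨((continuous_gibbsWeight hU θ).div_const _).measurable,
    fun x => (gibbsDensity_pos hU hsq θ x).le, integral_gibbsDensity hU hsq θ, ?_, ?_, hE⟩
  · simpa only [gibbsDensity, div_mul_eq_mul_div, smul_eq_mul, sub_zero] using
      ((gaussianGrowth_norm_sub_sq (0 : Euc d)).integrable hU hsq θ).div_const (partitionFn U θ)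
  · simp only [log_gibbsDensity hU hsq, mul_sub, mul_add, mul_neg]
    exact (hE.neg.add hI).sub ((integrable_gibbsDensity hU hsq θ).mul_const _)

lemma densMean_gibbsDensity (θ : Euc d) : densMean (gibbsDensity U θ) = gibbsMean U θ := by
  simp only [densMean, gibbsDensity, gibbsMean, div_eq_inv_mul, mul_smul]
  exact integral_smul _ _

lemma internalEnergy_gibbsDensity (hU : Continuous U) (hsq : SuperQuadratic U) (θ : Euc d) :
    internalEnergy U (gibbsDensity U θ)
      = ⟪gibbsMean U θ, θ⟫ - Real.log (partitionFn U θ) := by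
  have hq := admissibleDensity_gibbsDensity hU hsq θ
  rw [internalEnergy, ← integral_add hq.energy hq.ent, ← densMean_gibbsDensity,
    ← hq.integral_inner]
  have h1 : ∀ x, gibbsDensity U θ x * U x
      + gibbsDensity U θ x * Real.log (gibbsDensity U θ x)
      = gibbsDensity U θ x * ⟪x, θ⟫ - gibbsDensity U θ x * Real.log (partitionFn U θ) := by
    intro x; rw [log_gibbsDensity hU hsq]; ring
  simp only [h1]
  rw [integral_sub (hq.integrable_inner θ) (hq.integrable.mul_const _), integral_mul_const,
    hq.total, one_mul]

/-- The mean of the Gibbs measure is a subgradient of the log-partition function. -/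
lemma isSubgradient_log_partitionFn (hU : Continuous U) (hsq : SuperQuadratic U) :
    IsSubgradient (fun θ => Real.log (partitionFn U θ)) (gibbsMean U) := by
  intro x y
  have h1 := (admissibleDensity_gibbsDensity hU hsq x).inner_densMean_sub_log_partitionFn_le
    hU hsq y
  rw [internalEnergy_gibbsDensity hU hsq, densMean_gibbsDensity] at h1
  rw [inner_sub_right]
  linarith

/-- A self-consistent Gibbs density minimises the free energy. -/
lemma isLeast_freeEnergy (hU : Continuous U) (hsq : SuperQuadratic U) {g : Euc d → Euc d}
    (hg : IsSubgradient h g) {θ s : Euc d} (hs : s + g (gibbsMean U s) = θ) :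
    IsLeast {r : ℝ | ∃ ρ, AdmissibleDensity U ρ ∧ r = freeEnergy U h θ ρ}
      (freeEnergy U h θ (gibbsDensity U s)) := by
  have hq := admissibleDensity_gibbsDensity hU hsq s
  refine ⟨⟨_, hq, rfl⟩, ?_⟩
  rintro _ ⟨ρ, hρ, rfl⟩
  rw [hq.freeEnergy_eq, hρ.freeEnergy_eq, internalEnergy_gibbsDensity hU hsq,
    densMean_gibbsDensity, ← hs]
  have h1 := hρ.inner_densMean_sub_log_partitionFn_le hU hsq s
  have h2 := hg (gibbsMean U s) (densMean ρ)
  rw [inner_sub_right, real_inner_comm, real_inner_comm (gibbsMean U s)] at h2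
  rw [inner_add_right, inner_add_right]
  linarith

/-- The mean of the minimiser is a subgradient of minus the minimal free energy. -/
lemma isSubgradient_neg_sInf_freeEnergy (hU : Continuous U) (hsq : SuperQuadratic U)
    {g S : Euc d → Euc d} (hg : IsSubgradient h g)
    (hS : ∀ θ, S θ + g (gibbsMean U (S θ)) = θ) :
    IsSubgradient
      (fun θ => -sInf {r : ℝ | ∃ ρ, AdmissibleDensity U ρ ∧ r = freeEnergy U h θ ρ})
      (fun θ => gibbsMean U (S θ)) := by
  intro x y
  have hq := admissibleDensity_gibbsDensity hU hsq (S x)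
  have h1 := csInf_le (isLeast_freeEnergy hU hsq hg (hS y)).bddBelow ⟨_, hq, rfl⟩
  rw [hq.freeEnergy_eq, densMean_gibbsDensity] at h1
  beta_reduce
  rw [(isLeast_freeEnergy hU hsq hg (hS x)).csInf_eq, hq.freeEnergy_eq, densMean_gibbsDensity,
    inner_sub_right]
  linarith

end FreeEnergy

section Potential

variable {E : Type*} [NormedAddCommGroup E] [InnerProductSpace ℝ E]

lemma superQuadratic_of_rpow_le_inner_gradient [FiniteDimensional ℝ E] {V : E → ℝ}
    (hV : Differentiable ℝ V) {β R : ℝ} (hβ : 2 < β)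
    (h : ∀ x, R ≤ ‖x‖ → ‖x‖ ^ β ≤ ⟪x, gradient V x⟫) : SuperQuadratic V := by
  intro A
  obtain ⟨T, hT⟩ := eventually_atTop.1
    ((tendsto_rpow_atTop (sub_pos.2 hβ)).eventually_ge_atTop (2 * A))
  set s := max 1 (max R T) with hs
  have hs1 : 1 ≤ s := le_max_left _ _
  have hs0 : 0 < s := by linarith
  have hsR : R ≤ s := (le_max_left _ _).trans (le_max_right _ _)
  have hsT : T ≤ s := (le_max_right _ _).trans (le_max_right _ _)
  have key : ∀ x, s ≤ ‖x‖ → 2 * A * ‖x‖ ^ 2 ≤ ⟪x, gradient V x⟫ := fun x hx => by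
    have hx0 : 0 < ‖x‖ := hs0.trans_le hx
    refine le_trans ?_ (h x (hsR.trans hx))
    calc 2 * A * ‖x‖ ^ 2 ≤ ‖x‖ ^ (β - 2) * ‖x‖ ^ 2 := by
          gcongr; exact hT _ (hsT.trans hx)
      _ = ‖x‖ ^ β := by rw [← Real.rpow_natCast, ← Real.rpow_add hx0]; norm_num
  obtain ⟨C, hC⟩ : ∃ C, ∀ x, ‖x‖ ≤ s → A * ‖x‖ ^ 2 - C ≤ V x := by
    have hc : ContinuousOn (fun x => A * ‖x‖ ^ 2 - V x) (Metric.closedBall (0 : E) s) := by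
      have := hV.continuous
      fun_prop
    obtain ⟨C, hC⟩ := (isCompact_closedBall (0 : E) s).exists_bound_of_continuousOn hc
    refine ⟨C, fun x hx => ?_⟩
    have := (le_abs_self _).trans (hC x (by simpa using hx))
    linarith
  refine ⟨C, fun x => ?_⟩
  rcases le_total ‖x‖ s with hx | hx
  · exact hC x hx
  have hx0 : 0 < ‖x‖ := hs0.trans_le hx
  set φ : ℝ → ℝ := fun t => V (t • x) - A * (t ^ 2 * ‖x‖ ^ 2) with hφ
  have hd : ∀ t, HasDerivAt φ (⟪gradient V (t • x), x⟫ - A * (2 * t * ‖x‖ ^ 2)) t := fun t => by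
    have h1 : HasDerivAt (fun t : ℝ => t • x) x t := by
      simpa using (hasDerivAt_id t).smul_const x
    have h2 := (hV (t • x)).hasGradientAt.hasFDerivAt.comp_hasDerivAt t h1
    have h3 : HasDerivAt (fun t : ℝ => A * (t ^ 2 * ‖x‖ ^ 2)) (A * (2 * t * ‖x‖ ^ 2)) t := by
      simpa using ((hasDerivAt_pow 2 t).mul_const (‖x‖ ^ 2)).const_mul A
    exact h2.sub h3
  have hmono : MonotoneOn φ (Icc (s / ‖x‖) 1) := by
    refine monotoneOn_of_deriv_nonneg (convex_Icc _ _)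
      (fun t _ => (hd t).continuousAt.continuousWithinAt)
      (fun t _ => (hd t).differentiableAt.differentiableWithinAt) fun t ht => ?_
    rw [interior_Icc] at ht
    have ht0 : 0 < t := (div_pos hs0 hx0).trans ht.1
    have hn : ‖t • x‖ = t * ‖x‖ := by rw [norm_smul, Real.norm_eq_abs, abs_of_pos ht0]
    have h1 := key (t • x) (by rw [hn]; exact ((div_lt_iff₀ hx0).1 ht.1).le)
    rw [hn, inner_smul_left, real_inner_comm] at h1
    rw [(hd t).deriv]
    refine nonneg_of_mul_nonneg_right (a := t) ?_ ht0
    simp only [conj_trivial] at h1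
    linarith
  have h1 := hmono (left_mem_Icc.2 ((div_le_one hx0).2 hx)) (right_mem_Icc.2 ((div_le_one hx0).2 hx))
    ((div_le_one hx0).2 hx)
  have hn : ‖(s / ‖x‖) • x‖ = s := by
    rw [norm_smul, Real.norm_eq_abs, abs_of_pos (div_pos hs0 hx0)]; field_simp
  have h2 := hC ((s / ‖x‖) • x) hn.le
  simp only [hφ, one_smul] at h1
  rw [hn] at h2
  have h3 : (s / ‖x‖) ^ 2 * ‖x‖ ^ 2 = s ^ 2 := by field_simp
  rw [h3] at h1
  linarith

/-- A bounded perturbation of a strongly convex function is strongly midpoint convex up to a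
bounded error. -/
lemma strongConvexOn_add_bounded_midpoint {V Vc Vb : E → ℝ} (hdec : ∀ x, V x = Vc x + Vb x)
    {c B : ℝ} (hVc : StrongConvexOn univ c Vc) (hVb : ∀ x, |Vb x| ≤ B) (x y : E) :
    V ((1 / 2 : ℝ) • (x + y)) ≤ (V x + V y) / 2 - c / 8 * ‖x - y‖ ^ 2 + 2 * B := by
  obtain ⟨-, hc⟩ := hVc
  have h1 := hc (mem_univ x) (mem_univ y) (a := 1 / 2) (b := 1 / 2) (by norm_num)
    (by norm_num) (by norm_num)
  simp only [smul_eq_mul] at h1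
  rw [← smul_add] at h1
  rw [hdec, hdec x, hdec y]
  have h2 := abs_le.1 (hVb ((1 / 2 : ℝ) • (x + y)))
  have h3 := abs_le.1 (hVb x)
  have h4 := abs_le.1 (hVb y)
  linarith

lemma exists_contraction_of_norm_fderiv_lt_one [FiniteDimensional ℝ E] {f : E → E}
    (hf : ContDiff ℝ 1 f) {c : E} {r : ℝ} (hr : 0 ≤ r)
    (h : ∀ m ∈ Metric.closedBall c r, ‖fderiv ℝ f m‖ < 1) :
    ∃ ε > 0, ∃ q, 0 ≤ q ∧ q < 1 ∧
      ∀ m ∈ Metric.closedBall c (r + ε), ‖f m - f c‖ ≤ q * ‖m - c‖ := by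
  have hcont : Continuous fun m => ‖fderiv ℝ f m‖ := (hf.continuous_fderiv (by norm_num)).norm
  obtain ⟨ε, hε, hsub⟩ := (isCompact_closedBall c r).exists_cthickening_subset_open
    (isOpen_lt hcont continuous_const) h
  rw [cthickening_closedBall hε.le hr, add_comm] at hsub
  obtain ⟨m₀, hm₀, hmax⟩ := (isCompact_closedBall c (r + ε)).exists_isMaxOn
    ⟨c, Metric.mem_closedBall_self (by positivity)⟩ hcont.continuousOn
  refine ⟨ε, hε, ‖fderiv ℝ f m₀‖, norm_nonneg _, hsub hm₀, fun m hm => ?_⟩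
  exact (convex_closedBall c (r + ε)).norm_image_sub_le_of_norm_fderiv_le
    (fun x _ => hf.differentiable (by norm_num) x) (fun x hx => hmax hx)
    (Metric.mem_closedBall_self (by positivity)) hm

/-- Adding a sufficiently steep radial field outside a ball makes a monotone map with sublinear
growth, contracting near its fixed point, a global contraction towards the fixed point. -/
lemma exists_global_contraction {M g : E → E} {κ r ε q R A : ℝ} {θs ms : E} (hκ : 0 < κ)
    (hr : 0 < r) (hε : 0 < ε) (hq : q < 1)
    (hmono : ∀ x y, 0 ≤ ⟪M x - M y, x - y⟫) (hMs : M θs = ms)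
    (hloc : ∀ θ, ‖θ - θs‖ ≤ κ * (r + 2 * ε) → κ * ‖M θ - ms‖ ≤ q * ‖θ - θs‖)
    (hfar : ∀ θ, R ≤ ‖θ - θs‖ → κ * ‖M θ - ms‖ ≤ 1 / 2 * ‖θ - θs‖)
    (hnear : ∀ θ, ‖θ - θs‖ ≤ R → κ * ‖M θ - ms‖ ≤ 1 / 2 * A)
    (hg : ∀ x, ∃ a : ℝ, 0 ≤ a ∧ g x = a • (x - ms))
    (hgA : ∀ x, r + ε ≤ ‖x - ms‖ → ‖g x‖ = A) :
    ∃ τ < 1, ∀ θ, κ * ‖M θ - ms‖ ≤ τ * ‖θ + g (M θ) - θs‖ := by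
  refine ⟨max q (max ((r + ε) / (r + 2 * ε)) (1 / 2)),
    max_lt hq (max_lt ((div_lt_one (by positivity)).2 (by linarith)) (by norm_num)), fun θ => ?_⟩
  set τ := max q (max ((r + ε) / (r + 2 * ε)) (1 / 2))
  have hτ1 : q ≤ τ := le_max_left _ _
  have hτ2 : (r + ε) / (r + 2 * ε) ≤ τ := (le_max_left _ _).trans (le_max_right _ _)
  have hτ3 : 1 / 2 ≤ τ := (le_max_right _ _).trans (le_max_right _ _)
  have hτ0 : 0 ≤ τ := by linarith
  have hin : 0 ≤ ⟪θ - θs, g (M θ)⟫ := by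
    obtain ⟨a, ha, e⟩ := hg (M θ)
    rw [e, inner_smul_right, ← hMs, real_inner_comm]
    exact mul_nonneg ha (hmono _ _)
  have hsum : ‖θ + g (M θ) - θs‖ ^ 2
      = ‖θ - θs‖ ^ 2 + 2 * ⟪θ - θs, g (M θ)⟫ + ‖g (M θ)‖ ^ 2 := by
    rw [← norm_add_sq_real]; congr 2; abel
  have hn1 : ‖θ - θs‖ ≤ ‖θ + g (M θ) - θs‖ :=
    le_of_sq_le_sq (by rw [hsum]; nlinarith [sq_nonneg ‖g (M θ)‖]) (norm_nonneg _)
  have hn2 : ‖g (M θ)‖ ≤ ‖θ + g (M θ) - θs‖ :=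
    le_of_sq_le_sq (by rw [hsum]; nlinarith [sq_nonneg ‖θ - θs‖]) (norm_nonneg _)
  have hu : ∀ t, t ≤ τ → κ * ‖M θ - ms‖ ≤ t * ‖θ - θs‖ →
      κ * ‖M θ - ms‖ ≤ τ * ‖θ + g (M θ) - θs‖ := fun t ht h =>
    h.trans (mul_le_mul ht hn1 (norm_nonneg _) hτ0)
  rcases le_total ‖θ - θs‖ (κ * (r + 2 * ε)) with h1 | h1
  · exact hu q hτ1 (hloc θ h1)
  rcases le_total ‖M θ - ms‖ (r + ε) with h2 | h2
  · refine hu _ hτ2 ?_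
    calc κ * ‖M θ - ms‖ ≤ κ * (r + ε) := by gcongr
      _ = (r + ε) / (r + 2 * ε) * (κ * (r + 2 * ε)) := by field_simp
      _ ≤ _ := by gcongr
  rcases le_total ‖θ - θs‖ R with h3 | h3
  · refine (hnear θ h3).trans ?_
    rw [← hgA _ h2]
    exact mul_le_mul hτ3 hn2 (norm_nonneg _) hτ0
  · exact hu _ hτ3 (hfar θ h3)

end Potential

lemma fMap_eq_gibbsMean {d : ℕ} {σ κ : ℝ} {V V₀ : Euc d → ℝ} (hκ : κ = 1 / σ ^ 2)
    (hV : Continuous V) (hV₀ : ∀ x, V₀ x = (V x + ‖x‖ ^ 2 / 2) / σ ^ 2) (m : Euc d) :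
    fMap σ V m = gibbsMean V₀ (κ • m) := by
  set e := Real.exp (-κ * (‖m‖ ^ 2 / 2)) with he
  have he0 : 0 < e := Real.exp_pos _
  have hw : ∀ x, Real.exp (-(1 / σ ^ 2) * (V x + ‖x - m‖ ^ 2 / 2))
      = e * gibbsWeight V₀ (κ • m) x := fun x => by
    rw [he, gibbsWeight, ← Real.exp_add, hV₀, inner_smul_right, norm_sub_sq_real, hκ]
    congr 1; ring
  have hpos : ∀ x, 0 ≤ e * gibbsWeight V₀ (κ • m) x := fun x =>
    mul_nonneg he0.le (gibbsWeight_pos _ _).le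
  have hV₀c : Continuous V₀ := by
    rw [funext hV₀]; fun_prop
  have hmeas : Measurable fun x => ENNReal.ofReal (e * gibbsWeight V₀ (κ • m) x) :=
    (continuous_const.mul (continuous_gibbsWeight hV₀c _)).measurable.ennreal_ofReal
  have hZ : 0 ≤ ∫ x, e * gibbsWeight V₀ (κ • m) x := integral_nonneg hpos
  simp only [fMap, nuMeas, probOfDensity, hw]
  rw [integral_smul_measure, integral_withDensity_eq_integral_toReal_smul hmeas
    (Eventually.of_forall fun x => ENNReal.ofReal_lt_top)]
  simp only [ENNReal.toReal_ofReal (hpos _), ENNReal.toReal_inv, ENNReal.toReal_ofReal hZ, mul_smul]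
  rw [integral_const_mul, integral_smul, smul_smul, gibbsMean, partitionFn]
  congr 1
  field_simp

/-- **Proposition (existence of the modified energy, dimension `d`).** There exists a convex
`C²` function `h` with bounded gradient and Hessian, vanishing on `D = B̄(m*, r)`, such that
`w_h` is `C²`, has Hessian bounded below, and satisfies the coercivity condition of
Assumption LSIN2. -/
theorem exists_modified_h
    (d : ℕ) (hd : 1 ≤ d) (σ : ℝ) (hσ : 0 < σ)
    -- confining potential V
    (V Vc Vb : Euc d → ℝ) (hV : ContDiff ℝ 2 V) (hdec : ∀ x, V x = Vc x + Vb x)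
    (ρ₀ : ℝ) (hρ₀ : 0 < ρ₀) (hVc : StrongConvexOn Set.univ ρ₀ Vc)
    (Mb : ℝ) (hVb : ∀ x, |Vb x| ≤ Mb)
    (β R_V θ₀ : ℝ) (hβ : 2 < β) (hRV : 0 < R_V) (hθ₀ : 0 < θ₀)
    (hgrow : ∀ x : Euc d, R_V ≤ ‖x‖ →
      ⟪x, gradient V x⟫ ≥ ‖x‖ ^ β ∧ ‖gradient V x‖ ≤ ‖x‖ ^ θ₀)
    (L : ℝ) (hL : 0 < L)
    (hOS : ∀ x y : Euc d, ⟪gradient V x - gradient V y, x - y⟫ ≥ -L * ‖x - y‖ ^ 2)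
    -- κ and the effective single-particle potential
    (κ : ℝ) (hκ : κ = 1 / σ ^ 2)
    (V₀ : Euc d → ℝ) (hV₀ : ∀ x, V₀ x = (V x + ‖x‖ ^ 2 / 2) / σ ^ 2)
    -- attractor and metastable domain
    (mstar : Euc d) (hfixstar : fMap σ V mstar = mstar)
    (r : ℝ) (hr : 0 < r)
    (hcontr : ∀ m ∈ Metric.closedBall mstar r, ‖fderiv ℝ (fMap σ V) m‖ < 1)
    (huniq : ∀ m ∈ Metric.closedBall mstar r, fMap σ V m = m → m = mstar) :
    ∃ h : Euc d → ℝ, ContDiff ℝ 2 h ∧ ConvexOn ℝ Set.univ h ∧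
      (∃ M : ℝ, ∀ m, ‖gradient h m‖ ≤ M) ∧
      (∃ K : ℝ≥0, LipschitzWith K (gradient h)) ∧
      (∀ m ∈ Metric.closedBall mstar r, h m = 0) ∧
      ContDiff ℝ 2 (wFun V₀ h κ) ∧
      (∃ K : ℝ, ConvexOn ℝ Set.univ (fun θ => wFun V₀ h κ θ - K / 2 * ‖θ‖ ^ 2)) ∧
      (∃ θs : Euc d, ∃ η : ℝ, 0 < η ∧ ∀ θ : Euc d,
        ⟪θ - θs, gradient (wFun V₀ h κ) θ⟫ ≥ η * ‖θ - θs‖ ^ 2) := by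
  have hκ0 : 0 < κ := by rw [hκ]; positivity
  have hVc0 : Continuous V := hV.continuous
  have hU : Continuous V₀ := by rw [funext hV₀]; fun_prop
  have hsqV : SuperQuadratic V := superQuadratic_of_rpow_le_inner_gradient
    (hV.differentiable (by norm_num)) hβ fun x hx => (hgrow x hx).1
  have hsq : SuperQuadratic V₀ := fun A => by
    obtain ⟨C, hC⟩ := hsqV (A * σ ^ 2)
    refine ⟨C / σ ^ 2, fun x => ?_⟩
    rw [hV₀, le_div_iff₀ (by positivity), sub_mul, div_mul_cancel₀ _ (by positivity)]
    have := hC x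
    have := sq_nonneg ‖x‖
    linarith
  have hmid : ∀ x y, V₀ ((1 / 2 : ℝ) • (x + y))
      ≤ (V₀ x + V₀ y) / 2 - ρ₀ / (8 * σ ^ 2) * ‖x - y‖ ^ 2 + 2 * Mb / σ ^ 2 := by
    intro x y
    have h1 := strongConvexOn_add_bounded_midpoint hdec hVc hVb x y
    have h2 : ‖(1 / 2 : ℝ) • (x + y)‖ ^ 2 ≤ (‖x‖ ^ 2 + ‖y‖ ^ 2) / 2 := by
      have h3 := parallelogram_law_with_norm ℝ x y
      rw [norm_smul, mul_pow]
      norm_num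
      nlinarith [mul_self_nonneg ‖x - y‖]
    have h4 : (V₀ x + V₀ y) / 2 - ρ₀ / (8 * σ ^ 2) * ‖x - y‖ ^ 2 + 2 * Mb / σ ^ 2
        = ((V x + V y) / 2 - ρ₀ / 8 * ‖x - y‖ ^ 2 + 2 * Mb + (‖x‖ ^ 2 + ‖y‖ ^ 2) / 2 / 2)
          / σ ^ 2 := by
      rw [hV₀ x, hV₀ y]; field_simp; ring
    rw [h4, hV₀]
    gcongr
  set M : Euc d → Euc d := gibbsMean V₀ with hM
  have hM1 : ContDiff ℝ 1 M := contDiff_gibbsMean hU hsq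
  have hMsub : IsSubgradient (fun θ => Real.log (partitionFn V₀ θ)) M :=
    isSubgradient_log_partitionFn hU hsq
  obtain ⟨K, hK0, hK⟩ := exists_lipschitz_gibbsMean hU hsq (by positivity) hmid
  have hfM : fMap σ V = fun m => M (κ • m) := funext (fMap_eq_gibbsMean hκ hVc0 hV₀)
  set θs : Euc d := κ • mstar with hθs
  have hMs : M θs = mstar := (congrFun hfM mstar).symm.trans hfixstar
  have hf1 : ContDiff ℝ 1 (fMap σ V) := by
    rw [hfM]; exact hM1.comp (contDiff_const_smul κ)
  obtain ⟨ε₀, hε₀, q, hq0, hq1, hq⟩ := exists_contraction_of_norm_fderiv_lt_one hf1 hr.le hcontr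
  obtain ⟨R, hR0, hR⟩ := hMsub.exists_norm_sub_le (fun δ hδ => exists_log_partitionFn_le hU hsq hδ)
    (δ := 1 / (2 * κ)) (by positivity) θs mstar
  obtain ⟨h, g, Kg, hKg0, hgsub, hg1, hgA, hgL, hgz, hgrad, hgout⟩ :=
    exists_radial_barrier mstar (A := 2 * κ * (K * R)) (r := r) (ε := ε₀ / 2) (by positivity) hr
      (by positivity)
  obtain ⟨S, hS1, hS⟩ := exists_contDiff_inverse hM1 hg1 (c := 1 / (2 * K)) (by positivity)
    (fun x y => by
      rw [div_mul_eq_mul_div, one_mul, div_le_iff₀ (by positivity), mul_comm]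
      exact hMsub.cocoercive hK0 hK x y) hgsub.inner_nonneg hgA
  have hGsub := isSubgradient_neg_sInf_freeEnergy hU hsq hgsub hS
  set N : Euc d → Euc d := fun θ => M (S θ) with hN
  have hN1 : ContDiff ℝ 1 N := hM1.comp hS1
  have hwgrad : ∀ θ, HasGradientAt (wFun V₀ h κ) (κ⁻¹ • θ - N θ) θ := by
    intro θ
    have h1 := (hGsub.hasGradientAt hN1.continuous θ).hasFDerivAt
    have h2 := ((hasStrictFDerivAt_norm_sq θ).hasFDerivAt).mul_const (2 * κ)⁻¹
    have h3 := h2.sub h1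
    rw [hasGradientAt_iff_hasFDerivAt]
    refine (h3.congr_fderiv ?_).congr_of_eventuallyEq (Eventually.of_forall fun x => ?_)
    · ext v
      simp
      field_simp
    · simp only [wFun, Pi.sub_apply, div_eq_mul_inv, sub_neg_eq_add]
  have hNL : ∀ x y, ‖N x - N y‖ ≤ 2 * K * ‖x - y‖ := by
    intro x y
    have h1 := hMsub.cocoercive hK0 hK (S x) (S y)
    have h2 := hgsub.inner_nonneg (N x) (N y)
    have h3 : x - y = (S x - S y) + (g (N x) - g (N y)) := by
      calc x - y = (S x + g (N x)) - (S y + g (N y)) := by simp only [hN, hS]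
        _ = _ := by abel
    have h4 : ⟪N x - N y, x - y⟫ = ⟪N x - N y, S x - S y⟫ + ⟪g (N x) - g (N y), N x - N y⟫ := by
      rw [h3, inner_add_right, real_inner_comm (N x - N y) (g (N x) - g (N y))]
    have h5 : ‖N x - N y‖ ^ 2 ≤ 2 * K * ⟪N x - N y, x - y⟫ := by
      rw [h4]; nlinarith
    have h6 := real_inner_le_norm (N x - N y) (x - y)
    rcases (norm_nonneg (N x - N y)).eq_or_lt with h0 | h0
    · rw [← h0]; positivity
    · refine le_of_mul_le_mul_right ?_ h0
      nlinarith
  have hloc : ∀ θ, ‖θ - θs‖ ≤ κ * (r + 2 * (ε₀ / 2)) → κ * ‖M θ - mstar‖ ≤ q * ‖θ - θs‖ := by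
    intro θ hθ
    have h1 : ‖κ⁻¹ • θ - mstar‖ = κ⁻¹ * ‖θ - θs‖ := by
      have h2 : κ⁻¹ • θ - mstar = κ⁻¹ • (θ - θs) := by
        rw [hθs, smul_sub, inv_smul_smul₀ hκ0.ne']
      rw [h2, norm_smul, Real.norm_eq_abs, abs_of_pos (inv_pos.2 hκ0)]
    have h3 := hq (κ⁻¹ • θ) (by
      rw [mem_closedBall_iff_norm, h1, inv_mul_le_iff₀ hκ0]
      linarith)
    rw [hfixstar, h1, hfM] at h3
    simp only [smul_inv_smul₀ hκ0.ne'] at h3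
    calc κ * ‖M θ - mstar‖ ≤ κ * (q * (κ⁻¹ * ‖θ - θs‖)) := by gcongr
      _ = q * ‖θ - θs‖ := by field_simp
  have hfar : ∀ θ, R ≤ ‖θ - θs‖ → κ * ‖M θ - mstar‖ ≤ 1 / 2 * ‖θ - θs‖ := by
    intro θ hθ
    calc κ * ‖M θ - mstar‖ ≤ κ * (1 / (2 * κ) * ‖θ - θs‖) := by gcongr; exact hR θ hθ
      _ = 1 / 2 * ‖θ - θs‖ := by field_simp
  have hnear : ∀ θ, ‖θ - θs‖ ≤ R → κ * ‖M θ - mstar‖ ≤ 1 / 2 * (2 * κ * (K * R)) := by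
    intro θ hθ
    have h1 : ‖M θ - M θs‖ ≤ K * ‖θ - θs‖ := hK θ θs
    rw [hMs] at h1
    calc κ * ‖M θ - mstar‖ ≤ κ * (K * R) := by gcongr; exact h1.trans (by gcongr)
      _ = _ := by ring
  obtain ⟨τ, hτ1, hτ⟩ := exists_global_contraction hκ0 hr (half_pos hε₀) hq1 hMsub.inner_nonneg
    hMs hloc hfar hnear hgrad hgout
  have hhgrad : gradient h = g := funext fun x => (hgsub.hasGradientAt hg1.continuous x).gradient
  refine ⟨h, contDiff_two_of_hasGradientAt (hgsub.hasGradientAt hg1.continuous) hg1, hgsub.convexOn,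
    ⟨_, by rw [hhgrad]; exact hgA⟩, ⟨⟨Kg, hKg0⟩, ?_⟩, hgz,
    contDiff_two_of_hasGradientAt hwgrad ((contDiff_const_smul _).sub hN1),
    ⟨1 / κ - 4 * K, ?_⟩, θs, (1 - τ) / κ, div_pos (by linarith) hκ0, fun θ => ?_⟩
  · rw [hhgrad]
    exact LipschitzWith.of_dist_le_mul fun x y => by
      rw [dist_eq_norm, dist_eq_norm]; exact hgL x y
  · refine IsSubgradient.convexOn (g := fun θ => (4 * K) • θ - N θ) fun x y => ?_
    have h1 := hGsub.le_add_sq hNL x y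
    simp only [wFun]
    have h2 : ‖y - x‖ ^ 2 = ‖y‖ ^ 2 - ‖x‖ ^ 2 - 2 * ⟪x, y - x⟫ := by
      rw [norm_sub_sq_real, inner_sub_right, real_inner_self_eq_norm_sq, real_inner_comm]; ring
    have h3 : ∀ z : Euc d, ‖z‖ ^ 2 / (2 * κ) - (1 / κ - 4 * K) / 2 * ‖z‖ ^ 2 = 2 * K * ‖z‖ ^ 2 :=
      fun z => by field_simp; ring
    rw [h2] at h1
    rw [inner_sub_left, inner_smul_left]
    simp only [conj_trivial]
    linarith [h3 x, h3 y]
  · rw [(hwgrad θ).gradient]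
    have h1 : κ⁻¹ • θ - N θ = κ⁻¹ • (θ - θs) - (N θ - mstar) := by
      rw [hθs, smul_sub, inv_smul_smul₀ hκ0.ne']; abel
    have h2 := hτ (S θ)
    rw [hS] at h2
    have h3 := real_inner_le_norm (θ - θs) (N θ - mstar)
    rw [h1, inner_sub_right, inner_smul_right, real_inner_self_eq_norm_sq, ge_iff_le,
      div_mul_eq_mul_div, div_le_iff₀ hκ0]
    have h4 : κ * ⟪θ - θs, N θ - mstar⟫ ≤ τ * ‖θ - θs‖ ^ 2 :=
      calc κ * ⟪θ - θs, N θ - mstar⟫ ≤ κ * (‖θ - θs‖ * ‖N θ - mstar‖) := by gcongr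
        _ = ‖θ - θs‖ * (κ * ‖N θ - mstar‖) := by ring
        _ ≤ ‖θ - θs‖ * (τ * ‖θ - θs‖) := by gcongr
        _ = _ := by ring
    have h5 : κ⁻¹ * ‖θ - θs‖ ^ 2 * κ = ‖θ - θs‖ ^ 2 := by field_simp
    rw [sub_mul, sub_mul, h5]
    linarith

end
end

section
/- There exists C > 0 such that for every m ∈ ℝ^d, ∫_{ℝ^d} |x|² ν_m(dx) ≤ C·(1 + |m|^{2/(β−1)}); in particular, since 2/(β−1) < 2, one has |f(m)|/|m| → 0 as |m| → ∞. -/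
open MeasureTheory Real Filter Set
open scoped RealInnerProductSpace ENNReal NNReal

noncomputable section

/-- The unnormalised density of `ν_m`. -/
def nuDensity {d : ℕ} (σ : ℝ) (V : Euc d → ℝ) (m x : Euc d) : ℝ :=
  Real.exp (-(1 / σ ^ 2) * (V x + ‖x - m‖ ^ 2 / 2))

theorem mul_one_sub_le_sub_smul {E : Type*} [NormedAddCommGroup E] [InnerProductSpace ℝ E]
    [CompleteSpace E] {V : E → ℝ} (hV : Differentiable ℝ V) {x : E} {s c : ℝ} (hs : s ≤ 1)
    (hc : ∀ t ∈ Icc s 1, c ≤ ⟪x, gradient V (t • x)⟫) :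
    c * (1 - s) ≤ V x - V (s • x) := by
  have hderiv : ∀ t : ℝ, HasDerivAt (fun t : ℝ => V (t • x)) ⟪x, gradient V (t • x)⟫ t := by
    intro t
    have h1 : HasDerivAt (fun t : ℝ => t • x) x t := by
      simpa using (hasDerivAt_id t).smul_const x
    have h2 := (hV (t • x)).hasFDerivAt.comp_hasDerivAt t h1
    rw [inner_gradient_right]
    exact h2
  have hdiff : Differentiable ℝ (fun t : ℝ => V (t • x)) :=
    fun t => (hderiv t).differentiableAt
  have := (convex_Icc s 1).mul_sub_le_image_sub_of_le_deriv hdiff.continuous.continuousOn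
    hdiff.differentiableOn (C := c)
    (fun t ht => by rw [(hderiv t).deriv]; exact hc t (interior_subset ht))
    s ⟨le_rfl, hs⟩ 1 ⟨hs, le_rfl⟩ hs
  simpa using this

section Potential

variable {d : ℕ} {V : Euc d → ℝ} {β R_V : ℝ}

theorem exists_forall_neg_le_of_rpow_le_inner_gradient (hV : Differentiable ℝ V) (hRV : 0 < R_V)
    (hgrow : ∀ x : Euc d, R_V ≤ ‖x‖ → ‖x‖ ^ β ≤ ⟪x, gradient V x⟫) :
    ∃ B : ℝ, ∀ x, -B ≤ V x := by
  obtain ⟨B, hB⟩ := (isCompact_closedBall (0 : Euc d) R_V).exists_bound_of_continuousOn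
    hV.continuous.continuousOn
  refine ⟨B, fun x => ?_⟩
  rcases le_total ‖x‖ R_V with hx | hx
  · exact neg_le_of_abs_le (hB x (by simpa using hx))
  · have hx0 : 0 < ‖x‖ := hRV.trans_le hx
    have hs : 0 < R_V / ‖x‖ := div_pos hRV hx0
    have h := mul_one_sub_le_sub_smul hV (x := x) (c := 0) ((div_le_one hx0).2 hx) (by
      intro t ht
      have ht0 : 0 < t := hs.trans_le ht.1
      have hn : R_V ≤ ‖t • x‖ := by
        rw [norm_smul, Real.norm_of_nonneg ht0.le]
        exact (div_le_iff₀ hx0).1 ht.1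
      have h1 := (by positivity : 0 ≤ ‖t • x‖ ^ β).trans (hgrow _ hn)
      rw [real_inner_smul_left] at h1
      exact nonneg_of_mul_nonneg_right h1 ht0)
    have hn : (R_V / ‖x‖) • x ∈ Metric.closedBall (0 : Euc d) R_V := by
      rw [mem_closedBall_zero_iff, norm_smul, Real.norm_of_nonneg hs.le,
        div_mul_cancel₀ _ hx0.ne']
    have := neg_le_of_abs_le (hB _ hn)
    linarith

theorem half_smul_add_le_of_rpow_le_inner_gradient (hV : Differentiable ℝ V) (hβ : 1 < β)
    (hRV : 0 < R_V) (hgrow : ∀ x : Euc d, R_V ≤ ‖x‖ → ‖x‖ ^ β ≤ ⟪x, gradient V x⟫)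
    {m x : Euc d} {R : ℝ} (hR : R_V ≤ R) (hm : ‖m‖ ≤ R ^ (β - 1)) (hx : 2 * R ≤ ‖x‖) :
    V ((1 / 2 : ℝ) • x) + ‖(1 / 2 : ℝ) • x - m‖ ^ 2 / 2 + 3 / 8 * ‖x‖ ^ 2 ≤
      V x + ‖x - m‖ ^ 2 / 2 := by
  have hR0 : 0 < R := hRV.trans_le hR
  have h := mul_one_sub_le_sub_smul hV (x := x) (s := 1 / 2) (c := ‖x‖ * ‖m‖) (by norm_num) (by
    intro t ht
    have ht0 : 0 < t := lt_of_lt_of_le (by norm_num) ht.1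
    have hnt : ‖t • x‖ = t * ‖x‖ := by rw [norm_smul, Real.norm_of_nonneg ht0.le]
    have hn : R ≤ ‖t • x‖ := by
      rw [hnt]
      nlinarith [ht.1]
    have hn0 : 0 < ‖t • x‖ := hR0.trans_le hn
    have h1 := hgrow _ (hR.trans hn)
    have h2 : ‖m‖ ≤ ‖t • x‖ ^ (β - 1) :=
      hm.trans (Real.rpow_le_rpow hR0.le hn (by linarith))
    have h3 : ‖t • x‖ ^ β = ‖t • x‖ ^ (β - 1) * ‖t • x‖ := by
      rw [← Real.rpow_add_one hn0.ne', sub_add_cancel]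
    rw [h3, real_inner_smul_left] at h1
    have h4 := (mul_le_mul_of_nonneg_right h2 hn0.le).trans h1
    rw [hnt] at h4
    refine le_of_mul_le_mul_left ?_ ht0
    linarith)
  have h1 := norm_sub_sq_real x m
  have h2 := norm_sub_sq_real ((1 / 2 : ℝ) • x) m
  rw [real_inner_smul_left, norm_smul, Real.norm_of_nonneg (by norm_num : (0 : ℝ) ≤ 1 / 2)] at h2
  have h3 := real_inner_le_norm x m
  rw [h1, h2]
  nlinarith

theorem integrable_nuDensity {σ : ℝ} (hσ : 0 < σ) (hV : Continuous V) {B : ℝ}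
    (hB : ∀ x, -B ≤ V x) (m : Euc d) : Integrable (nuDensity σ V m) := by
  have hb : 0 < 1 / (2 * σ ^ 2) := by positivity
  have h0 : Integrable fun x : Euc d => Real.exp (-(1 / (2 * σ ^ 2)) * ‖x‖ ^ 2) := by
    have := (GaussianFourier.integrable_cexp_neg_mul_sq_norm_add (V := Euc d)
      (b := ((1 / (2 * σ ^ 2) : ℝ) : ℂ)) (by rwa [Complex.ofReal_re]) 0 0).norm
    refine this.congr (Eventually.of_forall fun x => ?_)
    simp only [Complex.norm_exp, zero_mul, add_zero]
    rw [← Complex.ofReal_neg, ← Complex.ofReal_pow, ← Complex.ofReal_mul, Complex.ofReal_re]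
  have h1 := (h0.comp_sub_right m).const_mul (Real.exp (1 / σ ^ 2 * B))
  refine h1.mono' ?_ (Eventually.of_forall fun x => ?_)
  · exact (by unfold nuDensity; fun_prop : Continuous (nuDensity σ V m)).aestronglyMeasurable
  · rw [nuDensity, Real.norm_of_nonneg (Real.exp_pos _).le, ← Real.exp_add, Real.exp_le_exp]
    have h2 : 0 ≤ 1 / σ ^ 2 * (V x + B) := mul_nonneg (by positivity) (by linarith [hB x])
    have h3 : 1 / (2 * σ ^ 2) = 1 / σ ^ 2 / 2 := by field_simp
    rw [h3]
    linarith

theorem norm_sq_mul_nuDensity_le {σ : ℝ} (hσ : 0 < σ) (hV : Differentiable ℝ V) (hβ : 1 < β)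
    (hRV : 0 < R_V) (hgrow : ∀ x : Euc d, R_V ≤ ‖x‖ → ‖x‖ ^ β ≤ ⟪x, gradient V x⟫)
    {m x : Euc d} {R : ℝ} (hR : R_V ≤ R) (hm : ‖m‖ ≤ R ^ (β - 1)) (hx : 2 * R ≤ ‖x‖) :
    ‖x‖ ^ 2 * nuDensity σ V m x ≤ 8 * σ ^ 2 / 3 * nuDensity σ V m ((1 / 2 : ℝ) • x) := by
  have h := half_smul_add_le_of_rpow_le_inner_gradient hV hβ hRV hgrow hR hm hx
  set u : ℝ := 3 / (8 * σ ^ 2) * ‖x‖ ^ 2 with hu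
  have h1 : nuDensity σ V m x ≤ Real.exp (-u) * nuDensity σ V m ((1 / 2 : ℝ) • x) := by
    rw [nuDensity, nuDensity, ← Real.exp_add, Real.exp_le_exp]
    have h2 := mul_le_mul_of_nonneg_left h (by positivity : 0 ≤ 1 / σ ^ 2)
    have h3 : u = 1 / σ ^ 2 * (3 / 8 * ‖x‖ ^ 2) := by rw [hu]; field_simp
    linarith
  have h2 : u * Real.exp (-u) ≤ 1 := by
    rw [Real.exp_neg, ← div_eq_mul_inv, div_le_one (Real.exp_pos _)]
    linarith [Real.add_one_le_exp u]
  have h3 : ‖x‖ ^ 2 = 8 * σ ^ 2 / 3 * u := by rw [hu]; field_simp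
  have h4 : 0 ≤ nuDensity σ V m ((1 / 2 : ℝ) • x) := (Real.exp_pos _).le
  calc ‖x‖ ^ 2 * nuDensity σ V m x
      ≤ ‖x‖ ^ 2 * (Real.exp (-u) * nuDensity σ V m ((1 / 2 : ℝ) • x)) := by gcongr
    _ = 8 * σ ^ 2 / 3 * ((u * Real.exp (-u)) * nuDensity σ V m ((1 / 2 : ℝ) • x)) := by
        rw [h3]; ring
    _ ≤ 8 * σ ^ 2 / 3 * (1 * nuDensity σ V m ((1 / 2 : ℝ) • x)) := by gcongr
    _ = _ := by rw [one_mul]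

theorem integral_nuMeas_eq {σ : ℝ} (hV : Continuous V) (m : Euc d) (φ : Euc d → ℝ) :
    ∫ x, φ x ∂(nuMeas σ V m) =
      (∫ x, nuDensity σ V m x)⁻¹ * ∫ x, φ x * nuDensity σ V m x := by
  have hcont : Continuous (nuDensity σ V m) := by unfold nuDensity; fun_prop
  have hpos : ∀ x, 0 ≤ nuDensity σ V m x := fun x => (Real.exp_pos _).le
  change ∫ x, φ x ∂(probOfDensity (nuDensity σ V m)) = _
  rw [probOfDensity, integral_smul_measure, integral_withDensity_eq_integral_toReal_smul
    hcont.measurable.ennreal_ofReal (Eventually.of_forall fun x => ENNReal.ofReal_lt_top),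
    ENNReal.toReal_inv, ENNReal.toReal_ofReal (integral_nonneg hpos), smul_eq_mul]
  congr 2
  ext x
  rw [ENNReal.toReal_ofReal (hpos x), smul_eq_mul, mul_comm]

/-- Integrating a function which is at most `a` near the origin and at most `a + |x|²` far away:
the contribution of the far region is bounded uniformly in `m`. -/
theorem integral_nuMeas_le {σ : ℝ} (hσ : 0 < σ) (hV : Differentiable ℝ V) (hβ : 1 < β)
    (hRV : 0 < R_V) (hgrow : ∀ x : Euc d, R_V ≤ ‖x‖ → ‖x‖ ^ β ≤ ⟪x, gradient V x⟫)
    {m : Euc d} {R : ℝ} (hR : R_V ≤ R) (hm : ‖m‖ ≤ R ^ (β - 1))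
    {φ : Euc d → ℝ} {a : ℝ} (hφ0 : ∀ x, 0 ≤ φ x)
    (hnear : ∀ x, ‖x‖ ≤ 2 * R → φ x ≤ a) (hfar : ∀ x, 2 * R ≤ ‖x‖ → φ x ≤ a + ‖x‖ ^ 2) :
    ∫ x, φ x ∂(nuMeas σ V m) ≤ a + 8 * σ ^ 2 / 3 * 2 ^ d := by
  obtain ⟨B, hB⟩ := exists_forall_neg_le_of_rpow_le_inner_gradient hV hRV hgrow
  have hint := integrable_nuDensity hσ hV.continuous hB m
  have hpos : ∀ x, 0 < nuDensity σ V m x := fun x => Real.exp_pos _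
  have hZ : 0 < ∫ x, nuDensity σ V m x := integral_exp_pos hint
  have hint2 : Integrable fun x => nuDensity σ V m ((1 / 2 : ℝ) • x) :=
    hint.comp_smul (by norm_num)
  have hscale : ∫ x, nuDensity σ V m ((1 / 2 : ℝ) • x) = 2 ^ d * ∫ x, nuDensity σ V m x := by
    rw [Measure.integral_comp_smul, finrank_euclideanSpace_fin, smul_eq_mul,
      abs_of_nonneg (by positivity)]
    simp
  have hle : ∫ x, φ x * nuDensity σ V m x ≤
      ∫ x, (a * nuDensity σ V m x + 8 * σ ^ 2 / 3 * nuDensity σ V m ((1 / 2 : ℝ) • x)) := by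
    refine integral_mono_of_nonneg
      (Eventually.of_forall fun x => mul_nonneg (hφ0 x) (hpos x).le)
      ((hint.const_mul a).add (hint2.const_mul _)) (Eventually.of_forall fun x => ?_)
    rcases le_total ‖x‖ (2 * R) with hx | hx
    · have h1 := mul_le_mul_of_nonneg_right (hnear x hx) (hpos x).le
      have h2 : 0 ≤ 8 * σ ^ 2 / 3 * nuDensity σ V m ((1 / 2 : ℝ) • x) :=
        mul_nonneg (by positivity) (hpos _).le
      change φ x * nuDensity σ V m x ≤ _
      linarith
    · have h1 := mul_le_mul_of_nonneg_right (hfar x hx) (hpos x).le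
      have h2 := norm_sq_mul_nuDensity_le hσ hV hβ hRV hgrow hR hm hx
      change φ x * nuDensity σ V m x ≤ _
      linarith
  rw [integral_add (hint.const_mul a) (hint2.const_mul _), integral_const_mul,
    integral_const_mul, hscale] at hle
  rw [integral_nuMeas_eq hV.continuous, inv_mul_le_iff₀ hZ]
  linarith

end Potential

theorem tendsto_affine_rpow_div_cocompact {d : ℕ} {γ : ℝ} (hγ : γ < 1) (A b : ℝ) :
    Tendsto (fun m : Euc d => (A + b * ‖m‖ ^ γ) / ‖m‖) (cocompact (Euc d)) (nhds 0) := by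
  have h1 : Tendsto (fun r : ℝ => A * r⁻¹ + b * r ^ (-(1 - γ))) atTop (nhds 0) := by
    simpa using (tendsto_inv_atTop_zero.const_mul A).add
      ((tendsto_rpow_neg_atTop (by linarith : 0 < 1 - γ)).const_mul b)
  have h2 : Tendsto (fun r : ℝ => (A + b * r ^ γ) / r) atTop (nhds 0) := by
    refine h1.congr' ?_
    filter_upwards [eventually_gt_atTop 0] with r hr
    rw [neg_sub, Real.rpow_sub_one hr.ne']
    ring
  exact h2.comp (tendsto_norm_cocompact_atTop (E := Euc d))

/-- **Lemma (second moment growth of `ν_m`).** There is `C > 0` with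
`∫ |x|² ν_m(dx) ≤ C(1 + |m|^{2/(β−1)})` for all `m`; in particular `|f(m)|/|m| → 0` as
`|m| → ∞`. -/
theorem nuMeas_second_moment
    (d : ℕ) (hd : 1 ≤ d) (σ : ℝ) (hσ : 0 < σ)
    -- confining potential V
    (V Vc Vb : Euc d → ℝ) (hV : ContDiff ℝ 2 V) (hdec : ∀ x, V x = Vc x + Vb x)
    (ρ₀ : ℝ) (hρ₀ : 0 < ρ₀) (hVc : StrongConvexOn Set.univ ρ₀ Vc)
    (Mb : ℝ) (hVb : ∀ x, |Vb x| ≤ Mb)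
    (β R_V θ₀ : ℝ) (hβ : 2 < β) (hRV : 0 < R_V) (hθ₀ : 0 < θ₀)
    (hgrow : ∀ x : Euc d, R_V ≤ ‖x‖ →
      ⟪x, gradient V x⟫ ≥ ‖x‖ ^ β ∧ ‖gradient V x‖ ≤ ‖x‖ ^ θ₀)
    (L : ℝ) (hL : 0 < L)
    (hOS : ∀ x y : Euc d, ⟪gradient V x - gradient V y, x - y⟫ ≥ -L * ‖x - y‖ ^ 2)
    :
    ∃ C : ℝ, 0 < C ∧
      (∀ m : Euc d, (∫ x, ‖x‖ ^ 2 ∂(nuMeas σ V m)) ≤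
        C * (1 + ‖m‖ ^ ((2 : ℝ) / (β - 1)))) ∧
      Tendsto (fun m : Euc d => ‖fMap σ V m‖ / ‖m‖) (cocompact (Euc d)) (nhds 0) := by
  have hVd : Differentiable ℝ V := hV.differentiable (by norm_num)
  have hβ1 : 0 < β - 1 := by linarith
  have hgrow' : ∀ x : Euc d, R_V ≤ ‖x‖ → ‖x‖ ^ β ≤ ⟪x, gradient V x⟫ :=
    fun x hx => (hgrow x hx).1
  set K : ℝ := 8 * σ ^ 2 / 3 * 2 ^ d with hK
  have hK0 : 0 < K := by positivity
  set R : Euc d → ℝ := fun m => R_V + ‖m‖ ^ (1 / (β - 1)) with hRdef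
  have hR : ∀ m, R_V ≤ R m := fun m => le_add_of_nonneg_right (by positivity)
  have hm : ∀ m, ‖m‖ ≤ R m ^ (β - 1) := fun m => by
    calc ‖m‖ = (‖m‖ ^ (1 / (β - 1))) ^ (β - 1) := by
          rw [← Real.rpow_mul (norm_nonneg _), one_div_mul_cancel hβ1.ne', Real.rpow_one]
      _ ≤ R m ^ (β - 1) :=
          Real.rpow_le_rpow (by positivity) (le_add_of_nonneg_left hRV.le) hβ1.le
  refine ⟨8 * R_V ^ 2 + K + 8, by positivity, fun m => ?_, ?_⟩
  · have h := integral_nuMeas_le hσ hVd (by linarith) hRV hgrow' (hR m) (hm m)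
      (φ := fun x => ‖x‖ ^ 2) (a := (2 * R m) ^ 2) (fun x => by positivity)
      (fun x hx => by gcongr) (fun x _ => le_add_of_nonneg_left (by positivity))
    have hp : ‖m‖ ^ ((2 : ℝ) / (β - 1)) = (‖m‖ ^ (1 / (β - 1))) ^ 2 := by
      rw [← Real.rpow_natCast, ← Real.rpow_mul (norm_nonneg _)]
      congr 1
      push_cast
      ring
    rw [hp]
    refine h.trans ?_
    simp only [hRdef, ← hK]
    set p := ‖m‖ ^ (1 / (β - 1))
    nlinarith [sq_nonneg (R_V - p), mul_nonneg (sq_nonneg R_V) (sq_nonneg p),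
      mul_nonneg hK0.le (sq_nonneg p)]
  · have hγ : 1 / (β - 1) < 1 := by
      rw [div_lt_one hβ1]
      linarith
    refine squeeze_zero (fun m => by positivity) (fun m => ?_)
      (tendsto_affine_rpow_div_cocompact hγ (2 * R_V + 1 + K) 2)
    gcongr
    have hR0 : 0 < R m := hRV.trans_le (hR m)
    have h := integral_nuMeas_le hσ hVd (by linarith) hRV hgrow' (hR m) (hm m)
      (φ := fun x => ‖x‖) (a := 2 * R m + 1) (fun x => norm_nonneg x)
      (fun x hx => by linarith) (fun x _ => by nlinarith [sq_nonneg (‖x‖ - 1 / 2)])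
    refine (norm_integral_le_integral_norm _).trans (h.trans (le_of_eq ?_))
    simp only [hRdef, ← hK]
    ring

end
end
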